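/- arXiv:1105.3564 — 5 statements merged into one kernel-verified Lean document; each statement's English description precedes it below -/
import Mathlib

section
/- Let G be a finite simple connected graph. There exists a minimal prime 𝔭 of S/I(G) with height(𝔭) = |E(G)| if and only if G is a cycle or G is the path graph with exactly two edges (the path 1−2−3). -/
open MvPolynomial

/-- Indicator: does the edge `e` cross the partition `A | Aᶜ`? -/
def crossBool {V : Type} [DecidableEq V] (A : Finset V) : Sym2 V → Bool :=
  Sym2.lift ⟨fun i j => xor (decide (i ∈ A)) (decide (j ∈ A)), fun i j => Bool.xor_comm _ _⟩

/-- The cut monomial `u_{A|B}` (with `B = Aᶜ`), formed from the edges in `E'`,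
viewed in the polynomial ring `S` on variables `s_e = X (e, true)`, `t_e = X (e, false)`
indexed by the edges of the ambient graph `G`. -/
noncomputable def cutGen (k : Type) [Field k] {V : Type} [DecidableEq V]
    (G : SimpleGraph V) (E' : Finset (Sym2 V)) (hE' : ↑E' ⊆ G.edgeSet) (A : Finset V) :
    MvPolynomial (↥G.edgeSet × Bool) k :=
  ∏ e ∈ E'.attach, X (⟨⟨e.1, hE' e.2⟩, crossBool A e.1⟩ : ↥G.edgeSet × Bool)

/-- The monomial cut ideal of the subgraph of `G` with edge set `E'`,
viewed as an ideal of the polynomial ring associated to `G`. -/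
noncomputable def cutIdealOn (k : Type) [Field k] {V : Type} [DecidableEq V]
    (G : SimpleGraph V) (E' : Finset (Sym2 V)) (hE' : ↑E' ⊆ G.edgeSet) :
    Ideal (MvPolynomial (↥G.edgeSet × Bool) k) :=
  Ideal.span (Set.range (cutGen k G E' hE'))

/-- The monomial cut ideal `I(G)` of the graph `G`. -/
noncomputable def cutIdeal (k : Type) [Field k] {V : Type} [DecidableEq V]
    (G : SimpleGraph V) [Fintype G.edgeSet] :
    Ideal (MvPolynomial (↥G.edgeSet × Bool) k) :=
  cutIdealOn k G G.edgeSet.toFinset (by simp)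


theorem MCI.X_mem {k σ : Type} [Field k] (C : Set σ) (i : σ) :
    (X i : MvPolynomial σ k) ∈ Ideal.span (X '' C : Set (MvPolynomial σ k)) ↔ i ∈ C := by
  classical
  rw [mem_ideal_span_X_image]
  constructor
  · intro h
    obtain ⟨j, hj, hne⟩ := h (Finsupp.single i 1) (by simp [support_X])
    rw [Finsupp.single_apply] at hne
    have : i = j := by
      by_contra hij
      simp [hij] at hne
    rwa [this]
  · intro h m hm
    rw [support_X, Finset.mem_singleton] at hm
    exact ⟨i, h, by simp [hm]⟩

theorem MCI.prime {k σ : Type} [Field k] (C : Set σ) :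
    (Ideal.span (X '' C : Set (MvPolynomial σ k))).IsPrime := by
  classical
  set I := Ideal.span (X '' C : Set (MvPolynomial σ k)) with hI
  let φ : MvPolynomial σ k →ₐ[k] MvPolynomial σ k := aeval (fun i => if i ∈ C then 0 else X i)
  have h1 : (Ideal.Quotient.mkₐ k I).comp φ = Ideal.Quotient.mkₐ k I := by
    ext i
    simp only [AlgHom.comp_apply, φ, aeval_X]
    split_ifs with h
    · rw [map_zero]
      symm
      exact Ideal.Quotient.eq_zero_iff_mem.2 (Ideal.subset_span ⟨i, h, rfl⟩)
    · rfl
  have h2 : I = RingHom.ker φ := by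
    apply le_antisymm
    · rw [hI, Ideal.span_le]
      rintro _ ⟨i, hi, rfl⟩
      simp [φ, hi]
    · intro p hp
      have h3 := DFunLike.congr_fun h1 p
      rw [AlgHom.comp_apply, (RingHom.mem_ker).1 hp, map_zero] at h3
      exact Ideal.Quotient.eq_zero_iff_mem.1 h3.symm
  rw [h2]
  exact RingHom.ker_isPrime _

theorem MCI.height {k σ : Type} [Field k] [Finite σ] [DecidableEq σ] (C : Finset σ) :
    (Ideal.span (X '' (C : Set σ) : Set (MvPolynomial σ k))).height = C.card := by
  apply le_antisymm
  · have hp := MCI.prime (k := k) (C : Set σ)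
    have := Ideal.height_le_card_of_mem_minimalPrimes_span
      (s := (X '' (C : Set σ) : Set (MvPolynomial σ k)))
      (p := Ideal.span (X '' (C : Set σ) : Set (MvPolynomial σ k)))
      (C.finite_toSet.image _) (by
        rw [Ideal.minimalPrimes_eq_subsingleton_self]; rfl)
    refine this.trans ?_
    have h2 := Set.ncard_image_le (f := (X : σ → MvPolynomial σ k)) C.finite_toSet
    rw [Set.ncard_coe_finset] at h2
    exact_mod_cast h2
  · induction C using Finset.induction_on with
    | empty => simp
    | insert a s ha ih =>
      have hp := MCI.prime (k := k) (s : Set σ)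
      have hp' := MCI.prime (k := k) ((insert a s : Finset σ) : Set σ)
      have hlt : Ideal.span (X '' (s : Set σ) : Set (MvPolynomial σ k)) <
          Ideal.span (X '' ((insert a s : Finset σ) : Set σ) : Set (MvPolynomial σ k)) := by
        refine lt_of_le_of_ne (Ideal.span_mono (Set.image_mono (by simp))) ?_
        intro h
        have h1 := (MCI.X_mem (k := k) ((insert a s : Finset σ) : Set σ) a).2 (by simp)
        rw [← h, MCI.X_mem] at h1
        exact ha (by simpa using h1)
      have := Ideal.height_add_one_le_of_lt_of_isPrime hlt
      rw [Finset.card_insert_of_notMem ha]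
      rw [Nat.cast_add, Nat.cast_one]
      exact (add_le_add_left ih 1).trans this

/-- A set of variables meeting every cut monomial. -/
def MCI.Cover {V : Type} [DecidableEq V] (G : SimpleGraph V)
    (C : Finset (↥G.edgeSet × Bool)) : Prop :=
  ∀ A : Finset V, ∃ e : G.edgeSet, (e, crossBool A e.1) ∈ C

theorem MCI.le_iff (k : Type) [Field k] {V : Type} [Fintype V] [DecidableEq V]
    (G : SimpleGraph V) [DecidableRel G.Adj]
    (p : Ideal (MvPolynomial (↥G.edgeSet × Bool) k)) [hp : p.IsPrime] :
    cutIdeal k G ≤ p ↔ ∀ A : Finset V, ∃ e : G.edgeSet, X (e, crossBool A e.1) ∈ p := by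
  unfold cutIdeal cutIdealOn
  rw [Ideal.span_le, Set.range_subset_iff]
  refine forall_congr' fun A => ?_
  unfold cutGen
  rw [SetLike.mem_coe, hp.prod_mem_iff]
  constructor
  · rintro ⟨e, -, he⟩
    exact ⟨_, he⟩
  · rintro ⟨e, he⟩
    exact ⟨⟨e.1, by simp⟩, Finset.mem_attach _ _, he⟩

theorem MCI.alg (k : Type) [Field k] {V : Type} [Fintype V] [DecidableEq V]
    (G : SimpleGraph V) [DecidableRel G.Adj] :
    (∃ p ∈ (cutIdeal k G).minimalPrimes, ∃ hp : p.IsPrime,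
        Order.height (⟨p, hp⟩ : PrimeSpectrum (MvPolynomial (↥G.edgeSet × Bool) k)) =
          (Fintype.card ↥G.edgeSet : ℕ∞)) ↔
      ∃ C : Finset (↥G.edgeSet × Bool), MCI.Cover G C ∧
        (∀ D, MCI.Cover G D → D ⊆ C → D = C) ∧ C.card = Fintype.card G.edgeSet := by
  classical
  let P (C : Finset (↥G.edgeSet × Bool)) : Ideal (MvPolynomial (↥G.edgeSet × Bool) k) :=
    Ideal.span (X '' (C : Set (↥G.edgeSet × Bool)))
  have hPp : ∀ C, (P C).IsPrime := fun C => MCI.prime _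
  have hPm : ∀ C v, X v ∈ P C ↔ v ∈ C := fun C v => (MCI.X_mem _ _).trans (by simp)
  have hPc : ∀ C, cutIdeal k G ≤ P C ↔ MCI.Cover G C := by
    intro C
    rw [MCI.le_iff (hp := hPp C)]
    simp only [hPm, MCI.Cover]
  have hPh : ∀ C, Order.height (⟨P C, hPp C⟩ :
      PrimeSpectrum (MvPolynomial (↥G.edgeSet × Bool) k)) = C.card := by
    intro C
    rw [← PrimeSpectrum.height_eq_orderHeight]
    exact MCI.height C
  let Q (p : Ideal (MvPolynomial (↥G.edgeSet × Bool) k)) : Finset (↥G.edgeSet × Bool) :=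
    Finset.univ.filter fun v => X v ∈ p
  have hQc : ∀ p : Ideal (MvPolynomial (↥G.edgeSet × Bool) k), p.IsPrime → cutIdeal k G ≤ p →
      MCI.Cover G (Q p) := by
    intro p hp h
    rw [MCI.le_iff] at h
    intro A
    obtain ⟨e, he⟩ := h A
    exact ⟨e, by simpa [Q] using he⟩
  have hQP : ∀ p, P (Q p) ≤ p := by
    intro p
    refine Ideal.span_le.2 ?_
    rintro _ ⟨v, hv, rfl⟩
    simpa [Q] using hv
  have hmono : ∀ C D, C ⊆ D → P C ≤ P D := fun C D h =>
    Ideal.span_mono (Set.image_mono (by exact_mod_cast h))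
  have hinj : ∀ C D, P C ≤ P D → C ⊆ D := fun C D h v hv => (hPm D v).1 (h ((hPm C v).2 hv))
  constructor
  · rintro ⟨p, hmin, hp, hh⟩
    have hc := hQc p hp hmin.1.2
    have hle := hmin.2 ⟨hPp (Q p), (hPc _).2 hc⟩ (hQP p)
    have heq : P (Q p) = p := le_antisymm (hQP p) hle
    refine ⟨Q p, hc, ?_, ?_⟩
    · intro D hD hDC
      have := hmin.2 ⟨hPp D, (hPc _).2 hD⟩ ((hmono _ _ hDC).trans (hQP p))
      exact Finset.Subset.antisymm hDC (hinj _ _ ((hQP p).trans this))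
    · have h1 := hPh (Q p)
      simp only [heq] at h1
      rw [hh] at h1
      exact_mod_cast h1.symm
  · rintro ⟨C, hC, hmin, hcard⟩
    refine ⟨P C, ⟨⟨hPp C, (hPc C).2 hC⟩, ?_⟩, hPp C, ?_⟩
    · rintro q ⟨hq, hIq⟩ hqC
      have := hmin (Q q) (hQc q hq hIq) (hinj _ _ ((hQP q).trans hqC))
      rw [← this]
      exact hQP q
    · rw [hPh, hcard]

theorem MCI.cross {V : Type} [DecidableEq V] (A : Finset V) (i j : V) :
    crossBool A s(i, j) = xor (decide (i ∈ A)) (decide (j ∈ A)) := rfl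

theorem MCI.cross_symmDiff {V : Type} [DecidableEq V] (A B : Finset V) (e : Sym2 V) :
    crossBool (symmDiff A B) e = xor (crossBool A e) (crossBool B e) := by
  induction e using Sym2.ind with
  | _ i j =>
    simp only [MCI.cross, Finset.mem_symmDiff]
    by_cases h1 : i ∈ A <;> by_cases h2 : i ∈ B <;> by_cases h3 : j ∈ A <;>
      by_cases h4 : j ∈ B <;> simp [h1, h2, h3, h4]

theorem MCI.cg_adj {n : ℕ} (hn : 3 ≤ n) (i j : Fin n) :
    (SimpleGraph.cycleGraph n).Adj i j ↔
      (j.val = i.val + 1 ∨ i.val = j.val + 1 ∨ (i.val = 0 ∧ j.val = n - 1) ∨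
        (j.val = 0 ∧ i.val = n - 1)) := by
  rw [SimpleGraph.cycleGraph_adj', Fin.sub_def, Fin.sub_def]
  have hi := i.2
  have hj := j.2
  simp only
  rcases lt_trichotomy i.val j.val with h | h | h
  · rw [Nat.mod_eq_of_lt (show n - j.val + i.val < n by omega),
      Nat.mod_eq_sub_mod (show n ≤ n - i.val + j.val by omega),
      Nat.mod_eq_of_lt (show n - i.val + j.val - n < n by omega)]
    omega
  · rw [h, show n - j.val + j.val = n by omega, Nat.mod_self]
    omega
  · rw [Nat.mod_eq_of_lt (show n - i.val + j.val < n by omega),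
      Nat.mod_eq_sub_mod (show n ≤ n - j.val + i.val by omega),
      Nat.mod_eq_of_lt (show n - j.val + i.val - n < n by omega)]
    omega

theorem MCI.const {n : ℕ} (hn : 3 ≤ n) (a : Fin n → Bool)
    (h : ∀ i j : Fin n, j.val = i.val + 1 → a i = a j) (i : Fin n) :
    a i = a ⟨0, by omega⟩ := by
  obtain ⟨i, hi⟩ := i
  induction i with
  | zero => rfl
  | succ i ih => rw [← ih (by omega)]; exact (h _ _ rfl).symm

theorem MCI.cyc_of {V : Type} [Fintype V] [DecidableEq V] (G : SimpleGraph V)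
    (hG : G.Connected) (e1 : G.edgeSet)
    (H1 : ∀ (e : G.edgeSet) (A : Finset V),
      ¬ ∀ e' : G.edgeSet, crossBool A e'.1 = decide (e'.1 = e.1))
    (H2 : ∀ e f : G.edgeSet, e ≠ f → ∃ A : Finset V, ∀ e' : G.edgeSet,
      (crossBool A e'.1 = true ↔ (e' = e ∨ e' = f))) :
    ∃ n : ℕ, 3 ≤ n ∧ Nonempty (G ≃g SimpleGraph.cycleGraph n) := by
  classical
  have hac : ¬ G.IsAcyclic := by
    intro hac
    obtain ⟨e, he⟩ := e1
    induction e using Sym2.ind with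
    | _ u v =>
      have hb := (SimpleGraph.isAcyclic_iff_forall_isBridge.1 hac) he
      rw [SimpleGraph.isBridge_iff] at hb
      refine H1 ⟨s(u, v), he⟩
        (Finset.univ.filter fun w => (G.deleteEdges {s(u, v)}).Reachable u w) ?_
      rintro ⟨e', he'⟩
      induction e' using Sym2.ind with
      | _ a b =>
        rw [MCI.cross]
        simp only [Finset.mem_filter, Finset.mem_univ, true_and]
        by_cases h : s(a, b) = s(u, v)
        · have hr : (G.deleteEdges {s(u, v)}).Reachable u u := SimpleGraph.Reachable.refl _
          rcases Sym2.eq_iff.1 h with ⟨rfl, rfl⟩ | ⟨rfl, rfl⟩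
          · simp [hb, hr]
          · simp [hb, hr]
        · have hadj : (G.deleteEdges {s(u, v)}).Adj a b := by
            rw [SimpleGraph.deleteEdges_adj]
            exact ⟨he', by simpa using h⟩
          have : (G.deleteEdges {s(u, v)}).Reachable u a ↔
              (G.deleteEdges {s(u, v)}).Reachable u b :=
            ⟨fun h => h.trans hadj.reachable, fun h => h.trans hadj.symm.reachable⟩
          simp [h, this]
  rw [SimpleGraph.isAcyclic_iff_free_cycleGraph] at hac
  push Not at hac
  obtain ⟨n, hn, hc⟩ := hac
  obtain ⟨f⟩ := hc
  have finj : Function.Injective f := f.injective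
  have fadj : ∀ {i j}, (SimpleGraph.cycleGraph n).Adj i j → G.Adj (f i) (f j) :=
    fun h => f.toHom.map_adj h
  have finj2 : ∀ i j i' j', s(f i, f j) = s(f i', f j') → s(i, j) = s(i', j') := by
    intro i j i' j' h
    rw [Sym2.eq_iff] at h ⊢
    rcases h with ⟨h1, h2⟩ | ⟨h1, h2⟩
    · exact Or.inl ⟨finj h1, finj h2⟩
    · exact Or.inr ⟨finj h1, finj h2⟩
  let z : Fin n := ⟨0, by omega⟩
  let l : Fin n := ⟨n - 1, by omega⟩
  have hzl : (SimpleGraph.cycleGraph n).Adj z l :=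
    (MCI.cg_adj hn _ _).2 (Or.inr (Or.inr (Or.inl ⟨rfl, rfl⟩)))
  have himg : ∀ a b, G.Adj a b → ∃ i j, (SimpleGraph.cycleGraph n).Adj i j ∧
      s(f i, f j) = s(a, b) := by
    intro a b hab
    by_contra hno
    push Not at hno
    obtain ⟨A, hA⟩ := H2 ⟨s(f z, f l), fadj hzl⟩ ⟨s(a, b), hab⟩ (by
      intro h
      exact hno z l hzl (congrArg Subtype.val h))
    have hconst := MCI.const hn (fun i => decide (f i ∈ A)) (by
      intro i j hij
      have hadj : (SimpleGraph.cycleGraph n).Adj i j := (MCI.cg_adj hn _ _).2 (Or.inl hij)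
      have h1 := hA ⟨s(f i, f j), fadj hadj⟩
      have h2 : ¬ (crossBool A s(f i, f j) = true) := by
        rw [h1]
        rintro (h | h)
        · have h3 := finj2 _ _ _ _ (congrArg Subtype.val h)
          have hj := j.2
          rcases Sym2.eq_iff.1 h3 with ⟨h4, h5⟩ | ⟨h4, h5⟩
          · have h6 := congrArg Fin.val h4
            have h7 := congrArg Fin.val h5
            simp only [z, l] at h6 h7
            omega
          · have h6 := congrArg Fin.val h4
            have h7 := congrArg Fin.val h5
            simp only [z, l] at h6 h7
            omega
        · exact hno i j hadj (congrArg Subtype.val h)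
      rw [MCI.cross] at h2
      simpa using h2)
    have h1 := (hA ⟨s(f z, f l), fadj hzl⟩).2 (Or.inl rfl)
    rw [MCI.cross] at h1
    have h2 := hconst l
    rw [h2] at h1
    simp [z] at h1
  have hsurj : Function.Surjective f := by
    intro v
    obtain ⟨w⟩ := hG.preconnected (f z) v
    have key : ∀ (u v : V), G.Walk u v → (∃ i, f i = u) → ∃ i, f i = v := by
      intro u v w
      induction w with
      | nil => exact id
      | cons h _ ih =>
        intro _
        apply ih
        obtain ⟨i, j, -, hij⟩ := himg _ _ h
        rcases Sym2.eq_iff.1 hij with ⟨h1, h2⟩ | ⟨h1, h2⟩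
        · exact ⟨j, h2⟩
        · exact ⟨i, h1⟩
    exact key _ _ w ⟨z, rfl⟩
  refine ⟨n, hn, ⟨SimpleGraph.Iso.symm
    { toEquiv := Equiv.ofBijective f ⟨finj, hsurj⟩, map_rel_iff' := ?_ }⟩⟩
  intro i j
  refine ⟨fun h => ?_, fun h => fadj h⟩
  obtain ⟨i', j', hadj, hij⟩ := himg _ _ h
  rcases Sym2.eq_iff.1 (finj2 _ _ _ _ hij) with ⟨h1, h2⟩ | ⟨h1, h2⟩
  · rwa [← h1, ← h2]
  · rw [← h1, ← h2]; exact hadj.symm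

theorem MCI.path_aux {V : Type} [DecidableEq V] (G : SimpleGraph V) (a b c : V)
    (hab : a ≠ b) (hac : a ≠ c) (hbc : b ≠ c) (hall : ∀ v, v = a ∨ v = b ∨ v = c)
    (h1 : G.Adj a b) (h2 : G.Adj b c) (h3 : ¬ G.Adj a c) :
    Nonempty (G ≃g SimpleGraph.pathGraph 3) := by
  have h3' : ¬ G.Adj c a := fun h => h3 h.symm
  have hbij : Function.Bijective (![a, b, c] : Fin 3 → V) := by
    constructor
    · intro i j hij
      fin_cases i <;> fin_cases j <;> simp_all
    · intro v
      rcases hall v with rfl | rfl | rfl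
      · exact ⟨0, rfl⟩
      · exact ⟨1, rfl⟩
      · exact ⟨2, rfl⟩
  refine ⟨SimpleGraph.Iso.symm
    { toEquiv := Equiv.ofBijective ![a, b, c] hbij, map_rel_iff' := ?_ }⟩
  intro i j
  rw [SimpleGraph.pathGraph_adj]
  fin_cases i <;> fin_cases j <;> simp [h1, h2, h3, h3', h1.symm, h2.symm]

theorem MCI.path_of {V : Type} [Fintype V] [DecidableEq V] (G : SimpleGraph V)
    [DecidableRel G.Adj] (hG : G.Connected) (hc : Fintype.card G.edgeSet = 2) :
    Nonempty (G ≃g SimpleGraph.pathGraph 3) := by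
  have hE : G.edgeFinset.card = 2 := by rw [SimpleGraph.edgeFinset_card]; exact hc
  have hle : Fintype.card V ≤ 3 := by
    have := hG.card_vert_le_card_edgeSet_add_one
    rw [Nat.card_eq_fintype_card, Nat.card_eq_fintype_card, hc] at this
    exact this
  have hge : 3 ≤ Fintype.card V := by
    by_contra hlt
    have h1 := G.card_edgeFinset_le_card_choose_two
    have h2 : (Fintype.card V).choose 2 ≤ Nat.choose 2 2 := Nat.choose_le_choose 2 (by omega)
    rw [hE] at h1
    simp at h2
    omega
  have h3 : (Finset.univ : Finset V).card = 3 := by rw [Finset.card_univ]; omega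
  obtain ⟨a, b, c, hab, hac, hbc, hu⟩ := Finset.card_eq_three.1 h3
  have hall : ∀ v, v = a ∨ v = b ∨ v = c := by
    intro v
    have := Finset.mem_univ v
    rw [hu] at this
    simpa using this
  have hEq : G.edgeFinset = ({s(a, b), s(a, c), s(b, c)} : Finset (Sym2 V)).filter
      (fun e => e ∈ G.edgeSet) := by
    ext e
    induction e using Sym2.ind with
    | _ u v =>
      simp only [SimpleGraph.mem_edgeFinset, Finset.mem_filter]
      refine ⟨fun h => ⟨?_, h⟩, fun h => h.2⟩
      have hne : u ≠ v := h.ne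
      rcases hall u with rfl | rfl | rfl <;> rcases hall v with rfl | rfl | rfl <;>
        first
        | exact absurd rfl hne
        | simp
  have n1 : s(a, b) ≠ s(a, c) := by
    intro h; rcases Sym2.eq_iff.1 h with ⟨_, h⟩ | ⟨h, _⟩ <;> contradiction
  have n2 : s(a, b) ≠ s(b, c) := by
    intro h; rcases Sym2.eq_iff.1 h with ⟨h, _⟩ | ⟨h, _⟩ <;> contradiction
  have n3 : s(a, c) ≠ s(b, c) := by
    intro h; rcases Sym2.eq_iff.1 h with ⟨h, _⟩ | ⟨h, _⟩ <;> contradiction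
  rw [hEq] at hE
  by_cases x : G.Adj a b <;> by_cases y : G.Adj a c <;> by_cases w : G.Adj b c <;>
    simp [Finset.filter_insert, Finset.filter_singleton, x, y, w, n1, n2, n3] at hE
  · exact MCI.path_aux G b a c hab.symm hbc hac (fun v => by have := hall v; tauto) x.symm y w
  · exact MCI.path_aux G a b c hab hac hbc hall x w y
  · exact MCI.path_aux G a c b hac hab hbc.symm (fun v => by have := hall v; tauto) y w.symm x

theorem MCI.path_cover {V : Type} [Fintype V] [DecidableEq V] (G : SimpleGraph V)
    [DecidableRel G.Adj] (h : Nonempty (G ≃g SimpleGraph.pathGraph 3)) :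
    ∃ C : Finset (↥G.edgeSet × Bool), MCI.Cover G C ∧
        (∀ D, MCI.Cover G D → D ⊆ C → D = C) ∧ C.card = Fintype.card G.edgeSet := by
  obtain ⟨φ⟩ := h
  have hcard : Fintype.card G.edgeSet = 2 := by
    letI : DecidableRel (SimpleGraph.pathGraph 3).Adj := fun u v =>
      decidable_of_iff _ SimpleGraph.pathGraph_adj.symm
    rw [← Nat.card_eq_fintype_card, Nat.card_congr φ.mapEdgeSet, Nat.card_eq_fintype_card]
    decide
  have hadj : G.Adj (φ.symm 0) (φ.symm 1) := by
    rw [SimpleGraph.Iso.map_adj_iff, SimpleGraph.pathGraph_adj]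
    simp
  let e : G.edgeSet := ⟨s(φ.symm 0, φ.symm 1), hadj⟩
  refine ⟨{(e, true), (e, false)}, ?_, ?_, ?_⟩
  · intro A
    refine ⟨e, ?_⟩
    cases crossBool A e.1 <;> simp
  · intro D hD hDC
    refine Finset.Subset.antisymm hDC ?_
    have h1 : (e, true) ∈ D := by
      obtain ⟨e', he'⟩ := hD {φ.symm 0}
      have := hDC he'
      have hee : e' = e := by
        simp only [Finset.mem_insert, Finset.mem_singleton, Prod.mk.injEq] at this
        tauto
      subst hee
      have h0 : crossBool {φ.symm 0} e.1 = true := by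
        show crossBool {φ.symm 0} s(φ.symm 0, φ.symm 1) = true
        rw [MCI.cross]
        simp [hadj.ne.symm]
      rwa [h0] at he'
    have h2 : (e, false) ∈ D := by
      obtain ⟨e', he'⟩ := hD ∅
      have := hDC he'
      have hee : e' = e := by
        simp only [Finset.mem_insert, Finset.mem_singleton, Prod.mk.injEq] at this
        tauto
      subst hee
      have h0 : crossBool ∅ e.1 = false := by
        show crossBool ∅ s(φ.symm 0, φ.symm 1) = false
        rw [MCI.cross]
        simp
      rwa [h0] at he'
    intro v hv
    simp only [Finset.mem_insert, Finset.mem_singleton] at hv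
    rcases hv with rfl | rfl <;> assumption
  · rw [hcard]
    exact Finset.card_pair (by simp)

theorem MCI.cyc_cover {V : Type} [Fintype V] [DecidableEq V] (G : SimpleGraph V)
    [DecidableRel G.Adj] (n : ℕ) (hn : 3 ≤ n) (φ : G ≃g SimpleGraph.cycleGraph n) :
    ∃ C : Finset (↥G.edgeSet × Bool), MCI.Cover G C ∧
        (∀ D, MCI.Cover G D → D ⊆ C → D = C) ∧ C.card = Fintype.card G.edgeSet := by
  let z : Fin n := ⟨0, by omega⟩
  let l : Fin n := ⟨n - 1, by omega⟩
  let e0 : Sym2 V := s(φ.symm z, φ.symm l)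
  have hadj : ∀ u v, G.Adj u v ↔ (SimpleGraph.cycleGraph n).Adj (φ u) (φ v) :=
    fun u v => (SimpleGraph.Iso.map_adj_iff φ).symm
  have he0 : ∀ u v, s(u, v) = e0 ↔ (((φ u).val = 0 ∧ (φ v).val = n - 1) ∨
      ((φ u).val = n - 1 ∧ (φ v).val = 0)) := by
    intro u v
    have hz : ∀ w, w = φ.symm z ↔ (φ w).val = 0 := by
      intro w
      rw [← φ.injective.eq_iff, RelIso.apply_symm_apply, Fin.ext_iff]
    have hl : ∀ w, w = φ.symm l ↔ (φ w).val = n - 1 := by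
      intro w
      rw [← φ.injective.eq_iff, RelIso.apply_symm_apply, Fin.ext_iff]
    rw [Sym2.eq_iff, hz, hl, hl, hz]
  have hm0 : e0 ∈ G.edgeSet := by
    show G.Adj _ _
    rw [hadj, RelIso.apply_symm_apply, RelIso.apply_symm_apply, MCI.cg_adj hn]
    exact Or.inr (Or.inr (Or.inl ⟨rfl, rfl⟩))
  let C : Finset (↥G.edgeSet × Bool) :=
    Finset.univ.image (fun e : G.edgeSet => (e, !decide (e.1 = e0)))
  have hCm : ∀ (e : G.edgeSet) (b : Bool), (e, b) ∈ C ↔ b ≠ decide (e.1 = e0) := by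
    intro e b
    simp only [C, Finset.mem_image, Finset.mem_univ, true_and, Prod.mk.injEq]
    constructor
    · rintro ⟨e', rfl, rfl⟩
      simp
    · intro h
      refine ⟨e, rfl, ?_⟩
      revert h
      cases b <;> cases decide (e.1 = e0) <;> simp
  have hA : ∀ e : G.edgeSet, ∃ A : Finset V, ∀ e' : G.edgeSet, e' ≠ e →
      crossBool A e'.1 = decide (e'.1 = e0) := by
    have main : ∀ i : Fin n, ∀ u v u' v' : V, (φ u).val = i.val → (φ v).val = i.val + 1 →
        G.Adj u' v' → s(u', v') ≠ s(u, v) →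
        crossBool (Finset.univ.filter fun w => φ w ≤ i) s(u', v') = decide (s(u', v') = e0) := by
      intro i u v u' v' hu hv hadj' hne
      rw [hadj, MCI.cg_adj hn] at hadj'
      have hne' : ¬ (((φ u').val = (φ u).val ∧ (φ v').val = (φ v).val) ∨
          ((φ u').val = (φ v).val ∧ (φ v').val = (φ u).val)) := by
        rintro (⟨h1, h2⟩ | ⟨h1, h2⟩)
        · exact hne (Sym2.eq_iff.2 (Or.inl ⟨φ.injective (Fin.ext h1), φ.injective (Fin.ext h2)⟩))
        · exact hne (Sym2.eq_iff.2 (Or.inr ⟨φ.injective (Fin.ext h1), φ.injective (Fin.ext h2)⟩))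
      rw [MCI.cross, Bool.eq_iff_iff, decide_eq_true_iff, he0]
      simp only [Finset.mem_filter, Finset.mem_univ, true_and, Fin.le_def, bne_iff_ne, ne_eq,
        decide_eq_decide]
      have := (φ v).2
      have := (φ u').2
      have := (φ v').2
      by_cases h1 : (φ u').val ≤ i.val <;> by_cases h2 : (φ v').val ≤ i.val <;>
        simp only [h1, h2, iff_self, not_true, not_false_iff, iff_true, iff_false, true_iff,
          false_iff] <;> omega
    rintro ⟨e, he⟩
    induction e using Sym2.ind with
    | _ u v =>
      have h1 := (MCI.cg_adj hn _ _).1 ((hadj u v).1 he)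
      by_cases h0 : s(u, v) = e0
      · refine ⟨∅, ?_⟩
        rintro ⟨e', he'⟩ hne
        have : e' ≠ e0 := fun h => hne (Subtype.ext (h.trans h0.symm))
        induction e' using Sym2.ind with
        | _ u' v' =>
          rw [MCI.cross]
          simp [this]
      · have h0' := h0
        rw [he0] at h0'
        have h1' : (φ v).val = (φ u).val + 1 ∨ (φ u).val = (φ v).val + 1 := by omega
        rcases h1' with h | h
        · refine ⟨Finset.univ.filter fun w => φ w ≤ φ u, ?_⟩
          rintro ⟨e', he'⟩ hne
          induction e' using Sym2.ind with
          | _ u' v' =>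
            exact main (φ u) u v u' v' rfl h he' (fun h => hne (Subtype.ext h))
        · refine ⟨Finset.univ.filter fun w => φ w ≤ φ v, ?_⟩
          rintro ⟨e', he'⟩ hne
          induction e' using Sym2.ind with
          | _ u' v' =>
            exact main (φ v) v u u' v' rfl h he'
              (fun h => hne (Subtype.ext (h.trans Sym2.eq_swap)))
  refine ⟨C, ?_, ?_, ?_⟩
  · intro A
    by_contra hno
    push Not at hno
    have hx : ∀ e : G.edgeSet, crossBool A e.1 = decide (e.1 = e0) := by
      intro e
      have := hno e
      rw [hCm] at this
      exact not_not.1 this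
    have hconst := MCI.const hn (fun i => decide (φ.symm i ∈ A)) (by
      intro i j hij
      have hij' : G.Adj (φ.symm i) (φ.symm j) := by
        rw [hadj, RelIso.apply_symm_apply, RelIso.apply_symm_apply, MCI.cg_adj hn]
        exact Or.inl hij
      have h1 := hx ⟨s(φ.symm i, φ.symm j), hij'⟩
      have h2 : ¬ s(φ.symm i, φ.symm j) = e0 := by
        rw [he0, RelIso.apply_symm_apply, RelIso.apply_symm_apply]
        omega
      simp only [h2, decide_false] at h1
      rw [MCI.cross] at h1
      simpa using h1)
    have h1 := hx ⟨e0, hm0⟩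
    simp only [decide_true] at h1
    rw [MCI.cross] at h1
    have h2 := hconst l
    rw [h2] at h1
    simp [z] at h1
  · intro D hD hDC
    refine Finset.Subset.antisymm hDC ?_
    rintro ⟨e, b⟩ heb
    obtain ⟨A, hA⟩ := hA e
    obtain ⟨e', he'⟩ := hD A
    have h1 := (hCm _ _).1 (hDC he')
    have hee : e' = e := by
      by_contra hne
      exact h1 (hA e' hne)
    subst hee
    have h2 := (hCm _ _).1 heb
    have : b = crossBool A e'.1 := by
      revert h1 h2
      cases b <;> cases crossBool A e'.1 <;> cases decide (e'.1 = e0) <;> simp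
    rwa [this]
  · rw [Finset.card_image_of_injective _ (fun a b h => congrArg Prod.fst h), Finset.card_univ]

theorem MCI.forward {V : Type} [Fintype V] [DecidableEq V] (G : SimpleGraph V)
    [DecidableRel G.Adj] (hG : G.Connected)
    (C : Finset (↥G.edgeSet × Bool)) (hC : MCI.Cover G C)
    (hmin : ∀ D, MCI.Cover G D → D ⊆ C → D = C) (hcard : C.card = Fintype.card G.edgeSet) :
      ((∃ n : ℕ, 3 ≤ n ∧ Nonempty (G ≃g SimpleGraph.cycleGraph n)) ∨
        Nonempty (G ≃g SimpleGraph.pathGraph 3)) := by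
  by_cases hb : ∃ e, (e, true) ∈ C ∧ (e, false) ∈ C
  · right
    obtain ⟨e, h1, h2⟩ := hb
    have := hmin {(e, true), (e, false)} (by
      intro A
      refine ⟨e, ?_⟩
      cases crossBool A e.1 <;> simp) (by
      intro v hv
      simp only [Finset.mem_insert, Finset.mem_singleton] at hv
      rcases hv with rfl | rfl <;> assumption)
    apply MCI.path_of G hG
    rw [← hcard, ← this]
    exact Finset.card_pair (by simp)
  · left
    have huniq : ∀ e b c, (e, b) ∈ C → (e, c) ∈ C → b = c := by
      intro e b c h1 h2
      by_contra hne
      apply hb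
      cases b <;> cases c <;> simp at hne
      · exact ⟨e, h2, h1⟩
      · exact ⟨e, h1, h2⟩
    have himg : C.image Prod.fst = Finset.univ := by
      rw [← Finset.card_eq_iff_eq_univ, ← hcard]
      apply Finset.card_image_of_injOn
      rintro ⟨e, b⟩ h1 ⟨e', c⟩ h2 h
      simp only at h
      subst h
      rw [huniq e b c h1 h2]
    have hex : ∀ e, ∃ b, (e, b) ∈ C := by
      intro e
      have := Finset.mem_univ e
      rw [← himg, Finset.mem_image] at this
      obtain ⟨⟨e', b⟩, h, rfl⟩ := this
      exact ⟨b, h⟩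
    choose β hβ using hex
    have hβ' : ∀ e c, (e, c) ∈ C ↔ c = β e :=
      fun e c => ⟨fun h => huniq e _ _ h (hβ e), fun h => h ▸ hβ e⟩
    have hA : ∀ e : G.edgeSet, ∃ A : Finset V, ∀ e' : G.edgeSet,
        crossBool A e'.1 = xor (!β e') (decide (e' = e)) := by
      intro e
      have hn : ¬ MCI.Cover G (C.erase (e, β e)) := by
        intro h
        have h1 := hmin _ h (Finset.erase_subset _ _)
        have h2 := hβ e
        rw [← h1] at h2
        simp at h2
      unfold MCI.Cover at hn
      push Not at hn
      obtain ⟨A, hA⟩ := hn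
      have hoff : ∀ e', e' ≠ e → crossBool A e'.1 ≠ β e' := by
        intro e' hne h
        apply hA e'
        rw [Finset.mem_erase]
        exact ⟨fun h => hne (congrArg Prod.fst h), (hβ' _ _).2 h⟩
      refine ⟨A, fun e' => ?_⟩
      by_cases h : e' = e
      · subst h
        obtain ⟨e'', he''⟩ := hC A
        rw [hβ'] at he''
        have : e'' = e' := by
          by_contra hne
          exact hoff _ hne he''
        subst this
        simp [he'']
      · have := hoff e' h
        simp only [h, decide_false, Bool.xor_false]
        revert this
        cases crossBool A e'.1 <;> cases β e' <;> simp
    have hne : ∀ A : Finset V, ¬ ∀ e' : G.edgeSet, crossBool A e'.1 = !β e' := by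
      intro A h
      obtain ⟨e, he⟩ := hC A
      rw [hβ', h] at he
      simp at he
    obtain ⟨e1, -⟩ := hC ∅
    apply MCI.cyc_of G hG e1
    · intro e A h
      obtain ⟨B, hB⟩ := hA e
      apply hne (symmDiff A B)
      intro e'
      rw [MCI.cross_symmDiff, h, hB]
      by_cases h : e' = e
      · simp [h]
      · have : e'.1 ≠ e.1 := fun h' => h (Subtype.ext h')
        simp [h, this]
    · intro e f hef
      obtain ⟨A, hA1⟩ := hA e
      obtain ⟨B, hB1⟩ := hA f
      refine ⟨symmDiff A B, fun e' => ?_⟩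
      rw [MCI.cross_symmDiff, hA1, hB1]
      by_cases h1 : e' = e
      · have h2 : e' ≠ f := fun h => hef (h1.symm.trans h)
        cases β e' <;> simp [h1, hef]
      · by_cases h2 : e' = f
        · cases β e' <;> simp [h2, hef.symm]
        · cases β e' <;> simp [h1, h2]

/-- For a finite simple connected graph `G`, there exists a minimal prime of `S/I(G)` of
height `|E(G)|` if and only if `G` is a cycle or `G` is the path graph with exactly two
edges (the path `1 - 2 - 3`). -/
theorem monomial_cut_ideal_exists_minimal_prime_of_max_height_iff
    (k : Type) [Field k] {V : Type} [Fintype V] [DecidableEq V]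
    (G : SimpleGraph V) [DecidableRel G.Adj] (hG : G.Connected) :
    (∃ p ∈ (cutIdeal k G).minimalPrimes, ∃ hp : p.IsPrime,
        Order.height (⟨p, hp⟩ : PrimeSpectrum (MvPolynomial (↥G.edgeSet × Bool) k)) =
          (Fintype.card ↥G.edgeSet : ℕ∞)) ↔
      ((∃ n : ℕ, 3 ≤ n ∧ Nonempty (G ≃g SimpleGraph.cycleGraph n)) ∨
        Nonempty (G ≃g SimpleGraph.pathGraph 3)) := by
  rw [MCI.alg]
  constructor
  · rintro ⟨C, hC, hmin, hcard⟩
    exact MCI.forward G hG C hC hmin hcard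
  · rintro (⟨n, hn, ⟨φ⟩⟩ | h)
    · exact MCI.cyc_cover G n hn φ
    · exact MCI.path_cover G h
end

section
/- Let G be a finite simple connected graph. Then the minimal primary decomposition of the monomial cut ideal is I(G) = ⋂_{C a cycle subgraph of G} ⋂_{𝔭 ∈ Min(I(C)), height(𝔭) > 2} 𝔭 ∩ ⋂_{{i,j} ∈ E(G)} (s_{ij}, t_{ij}), where for each cycle subgraph C of G the minimal primes of I(C) are viewed as (monomial) prime ideals of S generated by variables attached to edges of C. -/
open MvPolynomial

/-- The monomial cut ideal of a subgraph `H` of `G`, viewed as an ideal of the polynomial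
ring associated to `G`: it is generated by the cut monomials of the partitions, formed
using only the variables attached to the edges of `H`. -/
noncomputable def subgraphCutIdeal (k : Type) [Field k] {V : Type} [DecidableEq V]
    (G : SimpleGraph V) [Fintype G.edgeSet] (H : G.Subgraph) :
    Ideal (MvPolynomial (↥G.edgeSet × Bool) k) :=
  cutIdealOn k G ((Set.Finite.subset G.edgeSet.toFinite H.edgeSet_subset).toFinset)
    (by rw [Set.Finite.coe_toFinset]; exact H.edgeSet_subset)


namespace CutAux

variable {k : Type} [Field k] {V : Type} [DecidableEq V] {G : SimpleGraph V}

/-- The ideal generated by a set of variables. -/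
noncomputable def PT (k : Type) [Field k] {σ : Type} (T : Set σ) : Ideal (MvPolynomial σ k) :=
  Ideal.span (X '' T)

lemma X_mem_PT {σ : Type} (T : Set σ) (x : σ) : (X x : MvPolynomial σ k) ∈ PT k T ↔ x ∈ T := by
  classical
  rw [PT, mem_ideal_span_X_image]
  constructor
  · intro h
    obtain ⟨i, hi, h2⟩ := h (Finsupp.single x 1) (by simp [support_X])
    rw [Finsupp.single_apply] at h2
    have : x = i := by by_contra hne; simp [hne] at h2
    exact this ▸ hi
  · intro hx m hm
    rw [support_X, Finset.mem_singleton] at hm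
    exact ⟨x, hx, by simp [hm]⟩

lemma PT_prime {σ : Type} (T : Set σ) : (PT k T).IsPrime := by
  classical
  let φ : MvPolynomial σ k →ₐ[k] MvPolynomial σ k := aeval (fun x => if x ∈ T then 0 else X x)
  have h1 : ∀ f, f - φ f ∈ PT k T := by
    intro f
    induction f using MvPolynomial.induction_on with
    | C a => simp [φ]
    | add p q hp hq =>
      have : p + q - φ (p + q) = (p - φ p) + (q - φ q) := by rw [map_add]; ring
      rw [this]; exact add_mem hp hq
    | mul_X p x hp =>
      have : p * X x - φ (p * X x) = (p - φ p) * X x + φ p * (X x - φ (X x)) := by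
        rw [map_mul]; ring
      rw [this]
      refine add_mem (Ideal.mul_mem_right _ _ hp) (Ideal.mul_mem_left _ _ ?_)
      by_cases hx : x ∈ T
      · have : φ (X x) = 0 := by simp [φ, hx]
        rw [this, sub_zero]; exact (X_mem_PT T x).2 hx
      · have : φ (X x) = X x := by simp [φ, hx]
        simp [this]
  have : PT k T = RingHom.ker φ := by
    apply le_antisymm
    · rw [PT, Ideal.span_le]
      rintro _ ⟨x, hx, rfl⟩
      simp [RingHom.mem_ker, φ, hx]
    · intro f hf
      rw [RingHom.mem_ker] at hf
      have := h1 f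
      rwa [hf, sub_zero] at this
  rw [this]
  exact RingHom.ker_isPrime _

lemma PT_le_iff {σ : Type} (T T' : Set σ) : PT k T ≤ PT k T' ↔ T ⊆ T' := by
  constructor
  · intro h x hx
    exact (X_mem_PT T' x).1 (h ((X_mem_PT T x).2 hx))
  · intro h
    exact Ideal.span_mono (Set.image_mono h)

/-- `T` hits every cut monomial on the edges `E'`. -/
def Cov (G : SimpleGraph V) (E' : Finset (Sym2 V)) (T : Set (↥G.edgeSet × Bool)) : Prop :=
  ∀ A : Finset V, ∃ e : G.edgeSet, e.1 ∈ E' ∧ (e, crossBool A e.1) ∈ T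

lemma cutIdealOn_le_prime (E' : Finset (Sym2 V)) (hE' : ↑E' ⊆ G.edgeSet)
    (p : Ideal (MvPolynomial (↥G.edgeSet × Bool) k)) (hp : p.IsPrime) :
    cutIdealOn k G E' hE' ≤ p ↔ Cov G E' {x | X x ∈ p} := by
  rw [cutIdealOn, Ideal.span_le, Set.range_subset_iff]
  refine forall_congr' fun A => ?_
  rw [SetLike.mem_coe, cutGen, Ideal.IsPrime.prod_mem_iff]
  constructor
  · rintro ⟨e, -, he⟩
    exact ⟨⟨e.1, hE' e.2⟩, e.2, he⟩
  · rintro ⟨e, he, h⟩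
    exact ⟨⟨e.1, he⟩, Finset.mem_attach _ _, h⟩

lemma cutIdealOn_le_PT (E' : Finset (Sym2 V)) (hE' : ↑E' ⊆ G.edgeSet)
    (T : Set (↥G.edgeSet × Bool)) :
    cutIdealOn k G E' hE' ≤ PT k T ↔ Cov G E' T := by
  rw [cutIdealOn_le_prime _ _ _ (PT_prime T)]
  simp [X_mem_PT]

lemma mem_minimalPrimes (E' : Finset (Sym2 V)) (hE' : ↑E' ⊆ G.edgeSet)
    (p : Ideal (MvPolynomial (↥G.edgeSet × Bool) k)) :
    p ∈ (cutIdealOn k G E' hE').minimalPrimes ↔ ∃ T, Minimal (Cov G E') T ∧ p = PT k T := by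
  constructor
  · rintro ⟨⟨hp, hle⟩, hmin⟩
    have hc := (cutIdealOn_le_prime E' hE' p hp).1 hle
    have hPle : PT k {x | X x ∈ p} ≤ p := by
      rw [PT, Ideal.span_le]; rintro _ ⟨x, hx, rfl⟩; exact hx
    refine ⟨{x | X x ∈ p}, ⟨hc, ?_⟩, ?_⟩
    · intro T' hT' hle' x hx
      have h2 := hmin ⟨PT_prime T', (cutIdealOn_le_PT E' hE' T').2 hT'⟩
        (((PT_le_iff _ _).2 hle').trans hPle)
      exact (X_mem_PT _ _).1 (h2 hx)
    · exact le_antisymm (hmin ⟨PT_prime _, (cutIdealOn_le_PT E' hE' _).2 hc⟩ hPle) hPle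
  · rintro ⟨T, ⟨hT, hmin⟩, rfl⟩
    refine ⟨⟨PT_prime T, (cutIdealOn_le_PT E' hE' T).2 hT⟩, ?_⟩
    rintro q ⟨hq, hle⟩ hqle
    have hc := (cutIdealOn_le_prime E' hE' q hq).1 hle
    have := hmin hc (fun x hx => (X_mem_PT T x).1 (hqle hx))
    rw [PT, Ideal.span_le]
    rintro _ ⟨x, hx, rfl⟩
    exact this hx

lemma cutIdealOn_radical (E' : Finset (Sym2 V)) (hE' : ↑E' ⊆ G.edgeSet) :
    (cutIdealOn k G E' hE').radical = cutIdealOn k G E' hE' := by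
  classical
  refine le_antisymm ?_ Ideal.le_radical
  intro f hf
  have hT : ∀ T, Cov G E' T → f ∈ PT k T := fun T h => by
    have := (PT_prime (k := k) T).radical_le_iff.2 ((cutIdealOn_le_PT E' hE' T).2 h)
    exact this hf
  let d : Finset V → (↥G.edgeSet × Bool →₀ ℕ) := fun A =>
    ∑ e ∈ E'.attach, Finsupp.single (⟨⟨e.1, hE' e.2⟩, crossBool A e.1⟩ : ↥G.edgeSet × Bool) 1
  have hI : cutIdealOn k G E' hE' =
      Ideal.span ((fun s => monomial s (1 : k)) '' Set.range d) := by
    rw [cutIdealOn, ← Set.range_comp]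
    congr 2
    funext A
    simp only [Function.comp, d, cutGen, monomial_sum_one]
    rfl
  rw [hI, mem_ideal_span_monomial_image]
  intro m hm
  by_contra hcon
  push Not at hcon
  have hcov : Cov G E' {x | m x = 0} := by
    intro A
    by_contra hA
    push Not at hA
    refine hcon (d A) ⟨A, rfl⟩ ?_
    intro y
    by_cases hy : ∃ e : E', (⟨⟨e.1, hE' e.2⟩, crossBool A e.1⟩ : ↥G.edgeSet × Bool) = y
    · obtain ⟨e, rfl⟩ := hy
      have h1 := hA ⟨e.1, hE' e.2⟩ e.2
      simp only [d, Finsupp.finsetSum_apply]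
      rw [Finset.sum_eq_single_of_mem e (Finset.mem_attach _ _)]
      · simp only [Finsupp.single_eq_same]
        exact Nat.one_le_iff_ne_zero.2 h1
      · intro b _ hb
        rw [Finsupp.single_apply, if_neg]
        intro h
        apply hb
        have := congrArg (fun z => z.1.1) h
        exact Subtype.ext this
    · push Not at hy
      simp only [d, Finsupp.finsetSum_apply]
      rw [Finset.sum_eq_zero]
      · exact Nat.zero_le _
      · intro e _
        rw [Finsupp.single_apply, if_neg (hy e)]
  obtain ⟨i, hi, h2⟩ := mem_ideal_span_X_image.1 (hT _ hcov) m hm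
  exact h2 hi

lemma PT_height_gt {σ : Type} (T : Set σ) (x y z : σ) (hx : x ∈ T) (hy : y ∈ T)
    (hz : z ∈ T) (hxy : x ≠ y) (hxz : x ≠ z) (hyz : y ≠ z) :
    2 < Order.height (⟨PT k T, PT_prime T⟩ : PrimeSpectrum (MvPolynomial σ k)) := by
  let P : Set σ → PrimeSpectrum (MvPolynomial σ k) := fun T => ⟨PT k T, PT_prime T⟩
  have hlt : ∀ S S' : Set σ, S ⊆ S' → ∀ w, w ∈ S' → w ∉ S → P S < P S' := by
    intro S S' h w h1 h2
    refine lt_of_le_not_ge ((PT_le_iff _ _).2 h) fun hc => h2 ((PT_le_iff _ _).1 hc h1)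
  have h1 : P ∅ < P {x} := hlt _ _ (by simp) x (by simp) (by simp)
  have h2 : P {x} < P {x, y} := hlt _ _ (by simp) y (by simp) (by simpa using hxy.symm)
  have h3 : P {x, y} < P T := hlt _ _ (by rintro a (rfl | rfl) <;> assumption) z hz
    (by simp [hxz.symm, hyz.symm])
  have e1 := Order.height_add_one_le h1
  have e2 := Order.height_add_one_le h2
  have e3 := Order.height_add_one_le h3
  have : (3 : ℕ∞) ≤ Order.height (P T) := by
    calc (3 : ℕ∞) = 0 + 1 + 1 + 1 := by norm_num
      _ ≤ Order.height (P ∅) + 1 + 1 + 1 := by gcongr; exact zero_le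
      _ ≤ Order.height (P {x}) + 1 + 1 := by gcongr
      _ ≤ Order.height (P {x, y}) + 1 := by gcongr
      _ ≤ _ := e3
  exact lt_of_lt_of_le (by norm_num) this


lemma crossBool_mk (A : Finset V) (u v : V) :
    crossBool A s(u, v) = xor (decide (u ∈ A)) (decide (v ∈ A)) := rfl

lemma cov_pair (E' : Finset (Sym2 V)) (e : G.edgeSet) (he : e.1 ∈ E') :
    Cov G E' {(e, true), (e, false)} := by
  intro A
  refine ⟨e, he, ?_⟩
  cases crossBool A e.1 <;> simp

lemma exists_cross (e : G.edgeSet) (b : Bool) : ∃ A : Finset V, crossBool A e.1 = b := by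
  obtain ⟨e, he⟩ := e
  induction e using Sym2.ind with
  | _ u v =>
    have huv : u ≠ v := G.ne_of_adj he
    cases b
    · exact ⟨∅, by simp [crossBool_mk]⟩
    · exact ⟨{u}, by simp [crossBool_mk, huv.symm]⟩

lemma minimal_pair (E' : Finset (Sym2 V)) (e : G.edgeSet) (he : e.1 ∈ E') :
    Minimal (Cov G E') {(e, true), (e, false)} := by
  refine ⟨cov_pair E' e he, ?_⟩
  intro T hT hle
  have key : ∀ b, (e, b) ∈ T := by
    intro b
    obtain ⟨A, hA⟩ := exists_cross e b
    obtain ⟨e', -, h2⟩ := hT A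
    have h3 := hle h2
    have : e' = e := by
      rcases h3 with h3 | h3 <;> exact congrArg Prod.fst h3
    subst this
    rwa [hA] at h2
  rintro x (rfl | rfl) <;> exact key _

lemma minimal_crit {E' : Finset (Sym2 V)} {T : Set (↥G.edgeSet × Bool)}
    (hT : Minimal (Cov G E') T) {e0 : G.edgeSet} {b0 : Bool} (h0 : (e0, b0) ∈ T) :
    e0.1 ∈ E' ∧ ∃ A : Finset V, crossBool A e0.1 = b0 ∧
      ∀ e : G.edgeSet, e.1 ∈ E' → (e, crossBool A e.1) ∈ T → e = e0 := by
  have hn : ¬ Cov G E' (T \ {(e0, b0)}) := by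
    intro hc
    exact (hT.2 hc Set.sdiff_subset h0).2 rfl
  unfold Cov at hn
  push Not at hn
  obtain ⟨A, hA⟩ := hn
  have h1 : ∀ e : G.edgeSet, e.1 ∈ E' → (e, crossBool A e.1) ∈ T →
      (e, crossBool A e.1) = (e0, b0) := by
    intro e he hm
    by_contra hne
    exact hA e he ⟨hm, hne⟩
  obtain ⟨e, he, hm⟩ := hT.1 A
  have h2 := h1 e he hm
  have h3 : e = e0 := congrArg Prod.fst h2
  subst h3
  exact ⟨he, A, congrArg Prod.snd h2, fun e' he' hm' => congrArg Prod.fst (h1 e' he' hm')⟩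

/-- Support graph of `T`. -/
def supp (G : SimpleGraph V) (T : Set (↥G.edgeSet × Bool)) : SimpleGraph V where
  Adj u v := ∃ h : G.Adj u v, ∃ b, ((⟨s(u, v), h⟩ : G.edgeSet), b) ∈ T
  symm := ⟨by
    rintro u v ⟨h, b, hb⟩
    refine ⟨h.symm, b, ?_⟩
    have : (⟨s(v, u), h.symm⟩ : G.edgeSet) = ⟨s(u, v), h⟩ := Subtype.ext Sym2.eq_swap
    rwa [this]⟩
  loopless := ⟨fun u h => G.loopless.irrefl u h.1⟩

lemma not_bridge [Fintype V] {E' : Finset (Sym2 V)} {T : Set (↥G.edgeSet × Bool)}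
    (hT : Minimal (Cov G E') T)
    (hnp : ∀ e : G.edgeSet, ¬ ((e, true) ∈ T ∧ (e, false) ∈ T)) {u v : V}
    (huv : (supp G T).Adj u v) : ¬ (supp G T).IsBridge s(u, v) := by
  classical
  rw [SimpleGraph.isBridge_iff, not_not]
  by_contra hr
  obtain ⟨h, b0, h0⟩ := huv
  obtain ⟨-, A, hA0, hA⟩ := minimal_crit hT h0
  set H' := (supp G T).deleteEdges {s(u, v)} with hH'
  let A' : Finset V := Finset.univ.filter fun w => xor (decide (w ∈ A)) (decide (H'.Reachable u w))
  have hA' : ∀ w, decide (w ∈ A') = xor (decide (w ∈ A)) (decide (H'.Reachable u w)) := by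
    intro w
    simp only [A', Finset.mem_filter, Finset.mem_univ, true_and, Bool.decide_eq_true]
  obtain ⟨⟨e, he⟩, heE, hm⟩ := hT.1 A'
  induction e using Sym2.ind with
  | _ x y =>
    by_cases hxy : s(x, y) = s(u, v)
    · have hcr : crossBool A' s(x, y) = !b0 := by
        rw [hxy, crossBool_mk, hA', hA', ← hA0, crossBool_mk]
        simp only [SimpleGraph.Reachable.refl, decide_true, hr, decide_false]
        cases decide (u ∈ A) <;> cases decide (v ∈ A) <;> rfl
      have hee : (⟨s(x, y), he⟩ : G.edgeSet) = ⟨s(u, v), h⟩ := Subtype.ext hxy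
      rw [hcr, hee] at hm
      apply hnp ⟨s(u, v), h⟩
      cases b0
      · exact ⟨hm, h0⟩
      · exact ⟨h0, hm⟩
    · have hadj : H'.Adj x y := by
        rw [hH', SimpleGraph.deleteEdges_adj]
        exact ⟨⟨he, _, hm⟩, hxy⟩
      have hrr : H'.Reachable u x ↔ H'.Reachable u y :=
        ⟨fun q => q.trans hadj.reachable, fun q => q.trans hadj.symm.reachable⟩
      have hcr : crossBool A' s(x, y) = crossBool A s(x, y) := by
        rw [crossBool_mk, hA', hA', crossBool_mk]
        simp only [hrr]
        cases decide (x ∈ A) <;> cases decide (y ∈ A) <;> cases decide (H'.Reachable u y) <;> rfl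
      simp only [hcr] at hm
      exact hxy (congrArg Subtype.val (hA ⟨s(x, y), he⟩ heE hm))

lemma exists_cycle [Fintype V] {E' : Finset (Sym2 V)} {T : Set (↥G.edgeSet × Bool)}
    (hT : Minimal (Cov G E') T)
    (hnp : ∀ e : G.edgeSet, ¬ ((e, true) ∈ T ∧ (e, false) ∈ T)) :
    ∃ n, 3 ≤ n ∧ Nonempty ((SimpleGraph.cycleGraph n).Copy (supp G T)) := by
  by_contra hcon
  push Not at hcon
  have hac : (supp G T).IsAcyclic := by
    rw [SimpleGraph.isAcyclic_iff_free_cycleGraph]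
    intro n hn hc
    exact (hcon n hn).false hc.some
  obtain ⟨⟨e, he⟩, heE, hm⟩ := hT.1 ∅
  induction e using Sym2.ind with
  | _ x y =>
    have hadj : (supp G T).Adj x y := ⟨he, _, hm⟩
    refine not_bridge hT hnp hadj ?_
    rw [SimpleGraph.isBridge_iff_forall_cycle_notMem hadj]
    intro u p hp
    exact absurd hp (hac p)

lemma main_combi [Fintype V] {E' : Finset (Sym2 V)} {T : Set (↥G.edgeSet × Bool)}
    (hT : Minimal (Cov G E') T)
    (hnp : ∀ e : G.edgeSet, ¬ ((e, true) ∈ T ∧ (e, false) ∈ T)) :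
    ∃ C : G.Subgraph, (∃ n : ℕ, 3 ≤ n ∧ Nonempty (C.coe ≃g SimpleGraph.cycleGraph n)) ∧
      (∀ E'' : Finset (Sym2 V), (E'' : Set (Sym2 V)) = C.edgeSet → Cov G E'' T) ∧
      ∃ x y z, x ∈ T ∧ y ∈ T ∧ z ∈ T ∧ x ≠ y ∧ x ≠ z ∧ y ≠ z := by
  obtain ⟨n, hn, ⟨f⟩⟩ := exists_cycle hT hnp
  have hle : supp G T ≤ G := fun u v h => h.1
  let g : (SimpleGraph.cycleGraph n).Copy G := (SimpleGraph.Copy.ofLE _ _ hle).comp f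
  have hgf : ∀ i, g i = f i := fun i => rfl
  -- edges of the cycle
  let c : ℕ → V := fun i => f ⟨i % n, Nat.mod_lt _ (by omega)⟩
  have hc_inj : ∀ i j, i < n → j < n → c i = c j → i = j := by
    intro i j hi hj h
    have := congrArg Fin.val (f.injective h)
    simpa [Nat.mod_eq_of_lt hi, Nat.mod_eq_of_lt hj] using this
  have hadj : ∀ i, i + 1 < n → (SimpleGraph.cycleGraph n).Adj
      ⟨i % n, Nat.mod_lt _ (by omega)⟩ ⟨(i + 1) % n, Nat.mod_lt _ (by omega)⟩ := by
    intro i hi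
    rw [SimpleGraph.cycleGraph_adj']
    right
    rw [Fin.sub_val_of_le]
    · simp [Nat.mod_eq_of_lt hi, Nat.mod_eq_of_lt (show i < n by omega)]
    · simp [Fin.le_def, Nat.mod_eq_of_lt hi, Nat.mod_eq_of_lt (show i < n by omega)]
  have hadj0 : (SimpleGraph.cycleGraph n).Adj
      ⟨0 % n, Nat.mod_lt _ (by omega)⟩ ⟨(n - 1) % n, Nat.mod_lt _ (by omega)⟩ := by
    rw [SimpleGraph.cycleGraph_adj']
    left
    rw [Fin.coe_sub_iff_lt.2]
    · simp [Nat.mod_eq_of_lt (show n - 1 < n by omega)]; omega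
    · simp [Fin.lt_def, Nat.mod_eq_of_lt (show n - 1 < n by omega)]; omega
  have hT1 : ∀ i, i + 1 < n → (supp G T).Adj (c i) (c (i + 1)) := fun i hi =>
    f.toHom.map_adj (hadj i hi)
  have hT0 : (supp G T).Adj (c 0) (c (n - 1)) := f.toHom.map_adj hadj0
  have hC1 : ∀ i, i + 1 < n → s(c i, c (i + 1)) ∈ g.toSubgraph.edgeSet := by
    intro i hi
    exact ⟨_, _, hadj i hi, rfl, rfl⟩
  have hC0 : s(c 0, c (n - 1)) ∈ g.toSubgraph.edgeSet := ⟨_, _, hadj0, rfl, rfl⟩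
  have hne : ∀ i, i + 1 < n → s(c i, c (i + 1)) ≠ s(c 0, c (n - 1)) := by
    intro i hi h
    rw [Sym2.eq_iff] at h
    rcases h with ⟨h1, h2⟩ | ⟨h1, h2⟩
    · have := hc_inj _ _ (by omega) (by omega) h1
      have := hc_inj _ _ (by omega) (by omega) h2
      omega
    · have := hc_inj _ _ (by omega) (by omega) h2
      omega
  refine ⟨g.toSubgraph, ⟨n, hn, ⟨g.isoToSubgraph.symm⟩⟩, ?_, ?_⟩
  · intro E'' hE''
    by_contra hcov
    unfold Cov at hcov
    push Not at hcov
    obtain ⟨A0, hA0⟩ := hcov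
    obtain ⟨h, b0, h0⟩ := hT0
    obtain ⟨-, A, hAb, hA⟩ := minimal_crit hT h0
    have hmem : ∀ e, e ∈ g.toSubgraph.edgeSet → e ∈ E'' := by
      intro e he
      rw [← hE''] at he
      exact he
    have hstep : ∀ i, i + 1 < n →
        crossBool A s(c i, c (i + 1)) = crossBool A0 s(c i, c (i + 1)) := by
      intro i hi
      obtain ⟨h', b, hb⟩ := hT1 i hi
      have hE := (minimal_crit hT hb).1
      have h1 : crossBool A s(c i, c (i + 1)) ≠ b := by
        intro hq
        have := hA ⟨s(c i, c (i + 1)), h'⟩ hE (by rw [hq]; exact hb)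
        exact hne i hi (congrArg Subtype.val this)
      have h2 : crossBool A0 s(c i, c (i + 1)) ≠ b := by
        intro hq
        exact hA0 ⟨s(c i, c (i + 1)), h'⟩ (hmem _ (hC1 i hi)) (by rw [hq]; exact hb)
      revert h1 h2
      cases crossBool A s(c i, c (i + 1)) <;> cases crossBool A0 s(c i, c (i + 1)) <;>
        cases b <;> simp
    have hlast : crossBool A0 s(c 0, c (n - 1)) ≠ crossBool A s(c 0, c (n - 1)) := by
      intro hq
      refine hA0 ⟨s(c 0, c (n - 1)), h⟩ (hmem _ hC0) ?_
      rw [hq, hAb]; exact h0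
    have hconst : ∀ i, i < n → xor (decide (c i ∈ A)) (decide (c i ∈ A0)) =
        xor (decide (c 0 ∈ A)) (decide (c 0 ∈ A0)) := by
      intro i
      induction i with
      | zero => intro _; rfl
      | succ i ih =>
        intro hi
        rw [← ih (by omega)]
        have := hstep i hi
        rw [crossBool_mk, crossBool_mk] at this
        revert this
        cases decide (c i ∈ A) <;> cases decide (c i ∈ A0) <;>
          cases decide (c (i + 1) ∈ A) <;> cases decide (c (i + 1) ∈ A0) <;> simp
    have h3 := hconst (n - 1) (by omega)
    rw [crossBool_mk, crossBool_mk] at hlast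
    revert hlast h3
    cases decide (c 0 ∈ A) <;> cases decide (c 0 ∈ A0) <;>
      cases decide (c (n - 1) ∈ A) <;> cases decide (c (n - 1) ∈ A0) <;> simp
  · obtain ⟨h1, b1, hb1⟩ := hT1 0 (by omega)
    obtain ⟨h2, b2, hb2⟩ := hT1 1 (by omega)
    obtain ⟨h3, b3, hb3⟩ := hT0
    refine ⟨_, _, _, hb1, hb2, hb3, ?_, ?_, ?_⟩
    · intro h
      have h := congrArg (fun z => z.1.1) h
      simp only [Sym2.eq_iff] at h
      rcases h with ⟨h, -⟩ | ⟨h, -⟩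
      · have := hc_inj _ _ (by omega) (by omega) h
        omega
      · have := hc_inj _ _ (by omega) (by omega) h
        omega
    · intro h
      exact hne 0 (by omega) (congrArg (fun z => z.1.1) h)
    · intro h
      exact hne 1 (by omega) (congrArg (fun z => z.1.1) h)

lemma PT_pair {σ : Type} (x y : σ) : PT k {x, y} = Ideal.span {X x, X y} := by
  rw [PT, Set.image_pair]

lemma minimalPrimes_eq [Fintype V] [DecidableRel G.Adj] :
    (cutIdeal k G).minimalPrimes =
      {p : Ideal (MvPolynomial (↥G.edgeSet × Bool) k) |
        ∃ C : G.Subgraph, (∃ n : ℕ, 3 ≤ n ∧ Nonempty (C.coe ≃g SimpleGraph.cycleGraph n)) ∧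
          p ∈ (subgraphCutIdeal k G C).minimalPrimes ∧
          ∃ hp : p.IsPrime,
            2 < Order.height (⟨p, hp⟩ : PrimeSpectrum (MvPolynomial (↥G.edgeSet × Bool) k))} ∪
      Set.range (fun e : ↥G.edgeSet =>
        Ideal.span {X ((e, true) : ↥G.edgeSet × Bool), X ((e, false) : ↥G.edgeSet × Bool)}) := by
  ext p
  constructor
  · intro hp
    obtain ⟨T, hT, rfl⟩ := (mem_minimalPrimes _ _ p).1 hp
    by_cases hnp : ∀ e : G.edgeSet, ¬ ((e, true) ∈ T ∧ (e, false) ∈ T)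
    · left
      obtain ⟨C, hC, hcov, x, y, z, hx, hy, hz, hxy, hxz, hyz⟩ := main_combi hT hnp
      refine ⟨C, hC, ?_, PT_prime T, PT_height_gt T x y z hx hy hz hxy hxz hyz⟩
      refine (mem_minimalPrimes _ _ _).2 ⟨T, ⟨hcov _ (by simp), ?_⟩, rfl⟩
      intro T' hT' hle
      refine hT.2 ?_ hle
      intro A
      obtain ⟨e, -, h⟩ := hT' A
      exact ⟨e, by simp, h⟩
    · right
      push Not at hnp
      obtain ⟨e, h1, h2⟩ := hnp
      refine ⟨e, ?_⟩
      have hsub : ({(e, true), (e, false)} : Set (↥G.edgeSet × Bool)) ⊆ T := by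
        rintro x (rfl | rfl) <;> assumption
      have : T = {(e, true), (e, false)} :=
        Set.Subset.antisymm (hT.2 (cov_pair _ e (by simp)) hsub) hsub
      rw [this, PT_pair]
  · rintro (⟨C, -, hp, -⟩ | ⟨e, rfl⟩)
    · obtain ⟨T, hT, rfl⟩ := (mem_minimalPrimes _ _ p).1 hp
      refine (mem_minimalPrimes _ _ _).2 ⟨T, ⟨?_, ?_⟩, rfl⟩
      · intro A
        obtain ⟨e, -, h⟩ := hT.1 A
        exact ⟨e, by simp, h⟩
      · intro T' hT' hle
        refine hT.2 ?_ hle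
        intro A
        obtain ⟨e, -, h⟩ := hT' A
        exact ⟨e, (minimal_crit hT (hle h)).1, h⟩
    · exact (mem_minimalPrimes _ _ _).2 ⟨_, minimal_pair _ e (by simp), (PT_pair _ _).symm⟩

end CutAux

/-- For a finite simple connected graph `G`, the minimal primary decomposition of `I(G)` is
`I(G) = ⋂_{C cycle of G} ⋂_{p ∈ Min(I(C)), height p > 2} p ∩ ⋂_{{i,j} ∈ E(G)} (s_ij, t_ij)`;
minimality is expressed by the fact that the minimal primes of `I(G)` are exactly the
primes occurring in this intersection. -/
theorem monomial_cut_ideal_primary_decomposition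
    (k : Type) [Field k] {V : Type} [Fintype V] [DecidableEq V]
    (G : SimpleGraph V) [DecidableRel G.Adj] (hG : G.Connected) :
    cutIdeal k G =
      (⨅ C ∈ {C : G.Subgraph | ∃ n : ℕ, 3 ≤ n ∧ Nonempty (C.coe ≃g SimpleGraph.cycleGraph n)},
        ⨅ p ∈ {p : Ideal (MvPolynomial (↥G.edgeSet × Bool) k) |
            p ∈ (subgraphCutIdeal k G C).minimalPrimes ∧
            ∃ hp : p.IsPrime,
              2 < Order.height (⟨p, hp⟩ : PrimeSpectrum (MvPolynomial (↥G.edgeSet × Bool) k))},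
          p) ⊓
      (⨅ e : ↥G.edgeSet,
        Ideal.span {X ((e, true) : ↥G.edgeSet × Bool), X ((e, false) : ↥G.edgeSet × Bool)}) ∧
    (cutIdeal k G).minimalPrimes =
      {p : Ideal (MvPolynomial (↥G.edgeSet × Bool) k) |
        ∃ C : G.Subgraph, (∃ n : ℕ, 3 ≤ n ∧ Nonempty (C.coe ≃g SimpleGraph.cycleGraph n)) ∧
          p ∈ (subgraphCutIdeal k G C).minimalPrimes ∧
          ∃ hp : p.IsPrime,
            2 < Order.height (⟨p, hp⟩ : PrimeSpectrum (MvPolynomial (↥G.edgeSet × Bool) k))} ∪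
      Set.range (fun e : ↥G.edgeSet =>
        Ideal.span {X ((e, true) : ↥G.edgeSet × Bool), X ((e, false) : ↥G.edgeSet × Bool)}) := by
  have hmin := CutAux.minimalPrimes_eq (k := k) (G := G)
  refine ⟨?_, hmin⟩
  have hrad : cutIdeal k G = sInf (cutIdeal k G).minimalPrimes := by
    rw [Ideal.sInf_minimalPrimes]
    exact (CutAux.cutIdealOn_radical _ _).symm
  rw [hrad, hmin, sInf_union, sInf_range]
  congr 1
  apply le_antisymm
  · refine le_iInf₂ fun C hC => le_iInf₂ fun p hp => sInf_le ⟨C, hC, hp⟩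
  · refine le_sInf ?_
    rintro p ⟨C, hC, hp⟩
    exact iInf₂_le_of_le C hC (iInf₂_le p hp)
end

section
/- Let G be a finite simple connected graph with at least one edge. Then the Krull dimension of S/I(G) equals 2|E(G)| − 2. -/
open MvPolynomial

namespace CutDim

/-- Kill all variables not satisfying `p`. -/
noncomputable def killHom (k : Type) [Field k] {σ : Type} (p : σ → Prop) [DecidablePred p] :
    MvPolynomial σ k →ₐ[k] MvPolynomial {x // p x} k :=
  aeval (fun x => if h : p x then X ⟨x, h⟩ else 0)

lemma killHom_surjective (k : Type) [Field k] {σ : Type} (p : σ → Prop) [DecidablePred p] :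
    Function.Surjective (killHom k p) := by
  intro f
  refine ⟨rename Subtype.val f, ?_⟩
  rw [killHom, aeval_rename]
  have : ((fun x => if h : p x then (X ⟨x, h⟩ : MvPolynomial {x // p x} k) else 0) ∘ Subtype.val)
      = X := by
    funext x
    simp [x.2]
  rw [this]
  simp

lemma mk_surjective (k : Type) [Field k] {σ : Type} (p : σ → Prop)
    (I : Ideal (MvPolynomial σ k)) (hI : ∀ x, ¬ p x → X x ∈ I) :
    Function.Surjective ((Ideal.Quotient.mkₐ k I).comp
      (rename (Subtype.val : {x // p x} → σ))) := by
  rw [← AlgHom.range_eq_top, eq_top_iff]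
  have h1 : (⊤ : Subalgebra k (MvPolynomial σ k ⧸ I)) =
      (Algebra.adjoin k (Set.range (X : σ → MvPolynomial σ k))).map (Ideal.Quotient.mkₐ k I) := by
    rw [adjoin_range_X, Algebra.map_top, eq_comm, AlgHom.range_eq_top]
    exact Ideal.Quotient.mkₐ_surjective k I
  rw [h1, AlgHom.map_adjoin, Algebra.adjoin_le_iff]
  rintro _ ⟨_, ⟨x, rfl⟩, rfl⟩
  by_cases hx : p x
  · exact ⟨X ⟨x, hx⟩, by simp⟩
  · refine ⟨0, ?_⟩
    have := Ideal.Quotient.eq_zero_iff_mem.mpr (hI x hx)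
    simpa using this.symm

lemma dim_sub (k : Type) [Field k] {σ : Type} [Fintype σ] [DecidableEq σ] {a b : σ} (hab : a ≠ b) :
    ringKrullDim (MvPolynomial {x // x ≠ a ∧ x ≠ b} k) = ((Fintype.card σ - 2 : ℕ)) := by
  rw [MvPolynomial.ringKrullDim_of_isNoetherianRing, ringKrullDim_eq_zero_of_field, zero_add]
  have : Nat.card {x // x ≠ a ∧ x ≠ b} = Fintype.card σ - 2 := by
    rw [Nat.card_eq_fintype_card, Fintype.card_subtype]
    have : (Finset.univ.filter fun x => x ≠ a ∧ x ≠ b) = ({a, b} : Finset σ)ᶜ := by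
      ext x; simp
    rw [this, Finset.card_compl, Finset.card_pair hab]
  rw [this]

lemma lower (k : Type) [Field k] {σ : Type} [Fintype σ] [DecidableEq σ] {a b : σ} (hab : a ≠ b)
    (I : Ideal (MvPolynomial σ k)) (hI : ∀ f ∈ I, killHom k (fun x => x ≠ a ∧ x ≠ b) f = 0) :
    ((Fintype.card σ - 2 : ℕ) : WithBot ℕ∞) ≤ ringKrullDim (MvPolynomial σ k ⧸ I) := by
  rw [← dim_sub k hab]
  refine ringKrullDim_le_of_surjective
    (Ideal.Quotient.lift I (killHom k (fun x => x ≠ a ∧ x ≠ b)).toRingHom hI) ?_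
  exact Ideal.Quotient.lift_surjective_of_surjective _ _ (killHom_surjective k _)

lemma upper (k : Type) [Field k] {σ : Type} [Fintype σ] [DecidableEq σ]
    (I : Ideal (MvPolynomial σ k))
    (hI : ∀ P : Ideal (MvPolynomial σ k), P.IsPrime → I ≤ P → ∃ a b, a ≠ b ∧ X a ∈ P ∧ X b ∈ P) :
    ringKrullDim (MvPolynomial σ k ⧸ I) ≤ ((Fintype.card σ - 2 : ℕ) : WithBot ℕ∞) := by
  rw [ringKrullDim_quotient]
  refine iSup_le fun s => ?_
  obtain ⟨a, b, hab, ha, hb⟩ := hI s.head.1.asIdeal s.head.1.isPrime s.head.2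
  rw [← dim_sub k hab]
  have h2 := ringKrullDim_le_of_surjective _ (mk_surjective k (fun x => x ≠ a ∧ x ≠ b)
    s.head.1.asIdeal (by
      intro x hx
      by_cases h : x = a
      · exact h ▸ ha
      · by_cases h' : x = b
        · exact h' ▸ hb
        · exact absurd ⟨h, h'⟩ hx))
  refine le_trans ?_ h2
  rw [ringKrullDim_quotient]
  let t : LTSeries (PrimeSpectrum.zeroLocus (s.head.1.asIdeal : Set (MvPolynomial σ k))) :=
    { length := s.length
      toFun := fun i => ⟨(s i).1, fun x hx => (s.head_le i : s.head ≤ s i) hx⟩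
      step := fun i => s.step i }
  exact le_iSup (fun p : LTSeries (PrimeSpectrum.zeroLocus
    (s.head.1.asIdeal : Set (MvPolynomial σ k))) => (p.length : WithBot ℕ∞)) t

end CutDim

/-- For a finite simple connected graph `G` with at least one edge, the Krull dimension of
`S/I(G)` equals `2|E(G)| - 2`. -/
theorem monomial_cut_ideal_krullDim
    (k : Type) [Field k] {V : Type} [Fintype V] [DecidableEq V]
    (G : SimpleGraph V) [DecidableRel G.Adj] (hG : G.Connected)
    (hedge : 1 ≤ Fintype.card ↥G.edgeSet) :
    ringKrullDim (MvPolynomial (↥G.edgeSet × Bool) k ⧸ cutIdeal k G) =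
      ((2 * Fintype.card ↥G.edgeSet - 2 : ℕ)) := by
  have hc : Fintype.card (↥G.edgeSet × Bool) = 2 * Fintype.card ↥G.edgeSet := by
    rw [Fintype.card_prod, Fintype.card_bool, mul_comm]
  rw [← hc]
  apply le_antisymm
  · apply CutDim.upper
    intro P hP hIP
    have key : ∀ A : Finset V, ∃ e : G.edgeSet,
        (X (e, crossBool A e.1) : MvPolynomial (↥G.edgeSet × Bool) k) ∈ P := by
      intro A
      have h1 : cutGen k G G.edgeSet.toFinset (by simp) A ∈ P :=
        hIP (Ideal.subset_span ⟨A, rfl⟩)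
      rw [cutGen, hP.prod_mem_iff] at h1
      obtain ⟨e, -, he⟩ := h1
      exact ⟨_, he⟩
    obtain ⟨e, he⟩ := key ∅
    have h0 : crossBool (∅ : Finset V) e.1 = false := by
      induction e.1 using Sym2.ind with
      | _ x y => simp [crossBool]
    rw [h0] at he
    obtain ⟨A, hA⟩ : ∃ A : Finset V, crossBool A e.1 = true := by
      obtain ⟨e, hE⟩ := e
      induction e using Sym2.ind with
      | _ x y =>
        have hxy : x ≠ y := G.ne_of_adj hE
        exact ⟨{x}, by simp [crossBool, hxy.symm]⟩
    obtain ⟨e', he'⟩ := key A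
    refine ⟨_, _, ?_, he, he'⟩
    intro h
    rw [Prod.mk.injEq] at h
    obtain ⟨h, h'⟩ := h
    subst h
    rw [hA] at h'
    cases h'
  · obtain ⟨e⟩ : Nonempty G.edgeSet := Fintype.card_pos_iff.mp hedge
    have hab : ((e, true) : G.edgeSet × Bool) ≠ (e, false) := by simp
    apply CutDim.lower k hab
    intro f hf
    suffices h : cutIdeal k G ≤ RingHom.ker
        (CutDim.killHom k (fun x => x ≠ ((e, true) : G.edgeSet × Bool) ∧ x ≠ (e, false))) from h hf
    rw [cutIdeal, cutIdealOn, Ideal.span_le]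
    rintro _ ⟨A, rfl⟩
    change CutDim.killHom k _ _ = 0
    rw [cutGen, map_prod]
    refine Finset.prod_eq_zero (Finset.mem_attach _ ⟨e.1, by simp⟩) ?_
    rw [CutDim.killHom, aeval_X, dif_neg]
    cases crossBool A e.1 <;> simp
end

section
/- Let G be a finite simple connected graph. The ideal I(G) is unmixed — that is, all minimal primes of S/I(G) have the same height (equivalently, every minimal prime of S/I(G) has height 2) — if and only if G is a tree. -/
open MvPolynomial

section helpers

/-- The ideal generated by the variables in `s`. -/
noncomputable def varIdeal (k : Type) [Field k] {σ : Type} (s : Set σ) :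
    Ideal (MvPolynomial σ k) :=
  Ideal.span (X '' s)

open Classical in
/-- Setting the variables of `s` to zero. -/
noncomputable def killVars (k : Type) [Field k] {σ : Type} (s : Set σ) :
    MvPolynomial σ k →ₐ[k] MvPolynomial σ k :=
  aeval (fun i => if i ∈ s then 0 else X i)

lemma sub_killVars_mem (k : Type) [Field k] {σ : Type} (s : Set σ) (f : MvPolynomial σ k) :
    f - killVars k s f ∈ varIdeal k s := by
  induction f using MvPolynomial.induction_on with
  | C a => simp [killVars]
  | add p q hp hq =>
    have := add_mem hp hq
    rw [map_add]
    convert this using 1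
    ring
  | mul_X p i hp =>
    rw [map_mul]
    have hi : X i - killVars k s (X i) ∈ varIdeal k s := by
      by_cases h : i ∈ s
      · simpa [killVars, h, varIdeal] using Ideal.subset_span (Set.mem_image_of_mem X h)
      · simp [killVars, h]
    have := add_mem (Ideal.mul_mem_right (X i) _ hp)
      (Ideal.mul_mem_left _ (killVars k s p) hi)
    convert this using 1
    ring

lemma varIdeal_eq_ker (k : Type) [Field k] {σ : Type} (s : Set σ) :
    varIdeal k s = RingHom.ker (killVars k s) := by
  apply le_antisymm
  · rw [varIdeal, Ideal.span_le]
    rintro _ ⟨i, hi, rfl⟩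
    simp [killVars, hi]
  · intro f hf
    have := sub_killVars_mem k s f
    rw [RingHom.mem_ker] at hf
    rwa [hf, sub_zero] at this

lemma varIdeal_isPrime (k : Type) [Field k] {σ : Type} (s : Set σ) :
    (varIdeal k s).IsPrime := by
  rw [varIdeal_eq_ker]
  exact RingHom.ker_isPrime _

lemma X_mem_varIdeal {k : Type} [Field k] {σ : Type} {s : Set σ} {i : σ} :
    (X i : MvPolynomial σ k) ∈ varIdeal k s ↔ i ∈ s := by
  rw [varIdeal_eq_ker, RingHom.mem_ker]
  by_cases h : i ∈ s <;> simp [killVars, h]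

lemma varIdeal_mono {k : Type} [Field k] {σ : Type} {s t : Set σ} (h : s ⊆ t) :
    varIdeal k s ≤ varIdeal k t :=
  Ideal.span_mono (Set.image_mono h)

lemma card_le_height (k : Type) [Field k] {σ : Type} (s : Finset σ) :
    (s.card : ℕ∞) ≤ (varIdeal k (s : Set σ)).height := by
  classical
  induction s using Finset.induction_on with
  | empty => simp
  | insert a s ha ih =>
    haveI := varIdeal_isPrime k (s : Set σ)
    haveI := varIdeal_isPrime k ((insert a s : Finset σ) : Set σ)
    have hlt : varIdeal k (s : Set σ) < varIdeal k ((insert a s : Finset σ) : Set σ) := by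
      refine lt_of_le_of_ne (varIdeal_mono (by simp)) ?_
      intro h
      have : (X a : MvPolynomial σ k) ∈ varIdeal k (s : Set σ) := by
        rw [h, X_mem_varIdeal]; simp
      rw [X_mem_varIdeal] at this
      exact ha (by simpa using this)
    have := Ideal.height_add_one_le_of_lt_of_isPrime hlt
    rw [Finset.card_insert_of_notMem ha]
    rw [Nat.cast_add, Nat.cast_one]
    exact (add_le_add_left ih 1).trans this

lemma height_le_card (k : Type) [Field k] {σ : Type} [Finite σ] (s : Finset σ) :
    (varIdeal k (s : Set σ)).height ≤ s.card := by
  classical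
  haveI := varIdeal_isPrime k (s : Set σ)
  have h := Ideal.height_le_card_of_mem_minimalPrimes_span_finset
    (p := varIdeal k (s : Set σ)) (s := s.image (X : σ → MvPolynomial σ k)) (by
      have : Ideal.span ((s.image (X : σ → MvPolynomial σ k) : Finset _) : Set _)
          = varIdeal k (s : Set σ) := by simp [varIdeal]
      rw [this, Ideal.minimalPrimes_eq_subsingleton_self]
      simp)
  exact h.trans (by exact_mod_cast Finset.card_image_le)

lemma height_eq_card (k : Type) [Field k] {σ : Type} [Finite σ] (s : Finset σ) :
    (varIdeal k (s : Set σ)).height = s.card :=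
  le_antisymm (height_le_card k s) (card_le_height k s)

variable {k : Type} [Field k] {V : Type} [Fintype V] [DecidableEq V]
  {G : SimpleGraph V} [DecidableRel G.Adj]

lemma cutIdeal_le_iff {p : Ideal (MvPolynomial (↥G.edgeSet × Bool) k)} (hp : p.IsPrime) :
    cutIdeal k G ≤ p ↔ ∀ A : Finset V, ∃ e : G.edgeSet, X (e, crossBool A e.1) ∈ p := by
  rw [cutIdeal, cutIdealOn, Ideal.span_le]
  constructor
  · intro h A
    have := h (Set.mem_range_self A)
    rw [SetLike.mem_coe, cutGen, hp.prod_mem_iff] at this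
    obtain ⟨e, -, he⟩ := this
    exact ⟨⟨e.1, Set.mem_toFinset.1 e.2⟩, he⟩
  · rintro h _ ⟨A, rfl⟩
    rw [SetLike.mem_coe, cutGen, hp.prod_mem_iff]
    obtain ⟨e, he⟩ := h A
    exact ⟨⟨e.1, by simp⟩, Finset.mem_attach _ _, he⟩

lemma minimalPrime_eq_varIdeal {p : Ideal (MvPolynomial (↥G.edgeSet × Bool) k)}
    (hp : p ∈ (cutIdeal k G).minimalPrimes) : p = varIdeal k {i | X i ∈ p} := by
  have hle : varIdeal k {i | X i ∈ p} ≤ p := by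
    rw [varIdeal, Ideal.span_le]
    rintro _ ⟨i, hi, rfl⟩
    exact hi
  refine le_antisymm (hp.2 ⟨varIdeal_isPrime _ _, ?_⟩ hle) hle
  rw [cutIdeal_le_iff (varIdeal_isPrime _ _)]
  intro A
  obtain ⟨e, he⟩ := (cutIdeal_le_iff hp.1.1).1 hp.1.2 A
  exact ⟨e, X_mem_varIdeal.2 he⟩

lemma crossBool_mk (A : Finset V) (u v : V) :
    crossBool A s(u, v) = xor (decide (u ∈ A)) (decide (v ∈ A)) := rfl

lemma pair_le (e : G.edgeSet) : cutIdeal k G ≤ varIdeal k {(e, true), (e, false)} := by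
  rw [cutIdeal_le_iff (varIdeal_isPrime _ _)]
  intro A
  refine ⟨e, X_mem_varIdeal.2 ?_⟩
  cases crossBool A e.1 <;> simp

/-- Two distinct edges can be given any cut pattern. -/
lemma exists_cut_two (e f : G.edgeSet) (hef : e ≠ f) (b c : Bool) :
    ∃ A : Finset V, crossBool A e.1 = b ∧ crossBool A f.1 = c := by
  obtain ⟨e, he⟩ := e
  obtain ⟨f, hf⟩ := f
  induction e using Sym2.ind with
  | _ u v =>
  induction f using Sym2.ind with
  | _ x y =>
  have huv : u ≠ v := G.ne_of_adj he
  have hxy : x ≠ y := G.ne_of_adj hf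
  have hne : s(u, v) ≠ s(x, y) := fun h => hef (Subtype.ext h)
  simp only [crossBool_mk]
  have hne' : ¬ (u = x ∧ v = y) ∧ ¬ (u = y ∧ v = x) := by
    simpa [Sym2.eq_iff, not_or] using hne
  cases b <;> cases c
  · exact ⟨∅, by simp⟩
  · by_cases h1 : x = u ∨ x = v
    · refine ⟨{y}, ?_⟩
      have : u ≠ y := by grind
      have : v ≠ y := by grind
      simp [*]
    · refine ⟨{x}, ?_⟩
      push Not at h1
      simp [h1.1.symm, h1.2.symm, hxy.symm]
  · by_cases h1 : u = x ∨ u = y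
    · refine ⟨{v}, ?_⟩
      have : x ≠ v := by grind
      have : y ≠ v := by grind
      simp [*]
    · refine ⟨{u}, ?_⟩
      push Not at h1
      simp [h1.1.symm, h1.2.symm, huv.symm]
  · by_cases h1 : u = x ∨ u = y
    · refine ⟨{u}, ?_⟩
      grind
    · by_cases h2 : v = x ∨ v = y
      · refine ⟨{v}, ?_⟩
        grind
      · refine ⟨{u, x}, ?_⟩
        grind

lemma pair_mem_minimalPrimes (e : G.edgeSet) :
    varIdeal k {(e, true), (e, false)} ∈ (cutIdeal k G).minimalPrimes := by
  refine ⟨⟨varIdeal_isPrime _ _, pair_le e⟩, ?_⟩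
  rintro p ⟨hp, hle⟩ hpe
  have key : ∀ b, X (e, b) ∈ p := by
    intro b
    have : ∃ A : Finset V, crossBool A e.1 = b := by
      obtain ⟨e, he⟩ := e
      induction e using Sym2.ind with
      | _ u v =>
      have huv : u ≠ v := G.ne_of_adj he
      cases b
      · exact ⟨∅, by simp [crossBool_mk]⟩
      · exact ⟨{u}, by simp [crossBool_mk, huv.symm]⟩
    obtain ⟨A, hA⟩ := this
    obtain ⟨f, hf⟩ := (cutIdeal_le_iff hp).1 hle A
    have := X_mem_varIdeal.1 (hpe hf)
    have hfe : f = e := by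
      simp only [Set.mem_insert_iff, Set.mem_singleton_iff, Prod.mk.injEq] at this
      tauto
    subst hfe
    rwa [hA] at hf
  rw [varIdeal, Ideal.span_le]
  rintro _ ⟨i, hi, rfl⟩
  rcases hi with rfl | rfl <;> exact key _

lemma pair_height (e : G.edgeSet) :
    (varIdeal k {(e, true), (e, false)}).height = 2 := by
  classical
  have h := height_eq_card k ({(e, true), (e, false)} : Finset (G.edgeSet × Bool))
  have hc : ({(e, true), (e, false)} : Finset (G.edgeSet × Bool)).card = 2 := by
    rw [Finset.card_pair]; simp
  rw [hc] at h
  simpa using h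

lemma crossBool_symmDiff (A B : Finset V) (e : Sym2 V) :
    crossBool (symmDiff A B) e = xor (crossBool A e) (crossBool B e) := by
  induction e using Sym2.ind with
  | _ u v =>
  simp only [crossBool_mk, Finset.mem_symmDiff]
  by_cases h1 : u ∈ A <;> by_cases h2 : u ∈ B <;> by_cases h3 : v ∈ A <;> by_cases h4 : v ∈ B <;>
    simp [*]

lemma exists_bridge_cut (e : G.edgeSet) (he : G.IsBridge e.1) :
    ∃ A : Finset V, ∀ f : G.edgeSet, crossBool A f.1 = decide (f = e) := by
  classical
  obtain ⟨e, hE⟩ := e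
  induction e using Sym2.ind with
  | _ u v =>
  rw [SimpleGraph.isBridge_iff] at he
  refine ⟨Finset.univ.filter (fun w => (G.deleteEdges {s(u, v)}).Reachable u w), ?_⟩
  rintro ⟨f, hF⟩
  by_cases hfe : f = s(u, v)
  · subst hfe
    simp [crossBool_mk, he]
  · have : ¬ ((⟨f, hF⟩ : G.edgeSet) = ⟨s(u, v), hE⟩) := fun h => hfe (congrArg Subtype.val h)
    rw [decide_eq_false this]
    clear this
    induction f using Sym2.ind with
    | _ x y =>
    have hadj : (G.deleteEdges {s(u, v)}).Adj x y := by
      rw [SimpleGraph.deleteEdges_adj]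
      exact ⟨hF, hfe⟩
    have : (G.deleteEdges {s(u, v)}).Reachable u x ↔ (G.deleteEdges {s(u, v)}).Reachable u y :=
      ⟨fun h => h.trans hadj.reachable, fun h => h.trans hadj.symm.reachable⟩
    simp [crossBool_mk, this]

lemma exists_cut_of_acyclic (h : G.IsAcyclic) (b : G.edgeSet → Bool) :
    ∃ A : Finset V, ∀ f : G.edgeSet, crossBool A f.1 = b f := by
  classical
  have key : ∀ F : Finset G.edgeSet, ∃ A : Finset V, ∀ f : G.edgeSet,
      crossBool A f.1 = decide (f ∈ F) := by
    intro F
    induction F using Finset.induction_on with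
    | empty =>
      refine ⟨∅, ?_⟩
      rintro ⟨f, hf⟩
      induction f using Sym2.ind with
      | _ x y => simp [crossBool_mk]
    | insert e F he ih =>
      obtain ⟨A, hA⟩ := ih
      obtain ⟨B, hB⟩ := exists_bridge_cut e
        (by
          obtain ⟨e, hE⟩ := e
          induction e using Sym2.ind with
          | _ x y => exact SimpleGraph.isAcyclic_iff_forall_adj_isBridge.1 h hE)
      refine ⟨symmDiff A B, fun f => ?_⟩
      rw [crossBool_symmDiff, hA, hB]
      by_cases hfe : f = e
      · subst hfe; simp [he]
      · simp [hfe]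
  obtain ⟨A, hA⟩ := key (Finset.univ.filter (fun f => b f = true))
  exact ⟨A, fun f => by rw [hA]; simp⟩

lemma eq_pair_of_acyclic (h : G.IsAcyclic) {p : Ideal (MvPolynomial (↥G.edgeSet × Bool) k)}
    (hp : p ∈ (cutIdeal k G).minimalPrimes) :
    ∃ e : G.edgeSet, p = varIdeal k {(e, true), (e, false)} := by
  have : ∃ e : G.edgeSet, ∀ b, X (e, b) ∈ p := by
    by_contra! hcon
    choose b hb using hcon
    obtain ⟨A, hA⟩ := exists_cut_of_acyclic h b
    obtain ⟨e, he⟩ := (cutIdeal_le_iff hp.1.1).1 hp.1.2 A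
    rw [hA] at he
    exact hb e he
  obtain ⟨e, he⟩ := this
  have hle : varIdeal k {(e, true), (e, false)} ≤ p := by
    rw [varIdeal, Ideal.span_le]
    rintro _ ⟨i, hi, rfl⟩
    rcases hi with rfl | rfl <;> exact he _
  exact ⟨e, le_antisymm (hp.2 ⟨varIdeal_isPrime _ _, pair_le e⟩ hle) hle⟩

lemma acyclic_of_heights
    (h : ∀ p ∈ (cutIdeal k G).minimalPrimes, ∀ q ∈ (cutIdeal k G).minimalPrimes,
      p.height = q.height) : G.IsAcyclic := by
  classical
  rw [SimpleGraph.isAcyclic_iff_forall_adj_isBridge]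
  intro u v huv
  by_contra hb
  rw [SimpleGraph.isBridge_iff, not_not] at hb
  set e : G.edgeSet := ⟨s(u, v), huv⟩ with he
  set T : Set (G.edgeSet × Bool) := {i | i.2 = decide (i.1 ≠ e)} with hT
  have hTle : cutIdeal k G ≤ varIdeal k T := by
    rw [cutIdeal_le_iff (varIdeal_isPrime _ _)]
    intro A
    by_contra! hA
    have hA' : ∀ f : G.edgeSet, crossBool A f.1 = decide (f = e) := by
      intro f
      have := fun h' => hA f (X_mem_varIdeal.2 h')
      simp only [hT, Set.mem_ofPred_eq] at this
      by_cases hfe : f = e <;> simpa [hfe] using this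
    have hre : ∀ x y, (G.deleteEdges {s(u, v)}).Reachable x y → (x ∈ A ↔ y ∈ A) := by
      rintro x y ⟨w⟩
      induction w with
      | nil => rfl
      | @cons x' y' _ hadj _ ih =>
        rw [← ih]
        rw [SimpleGraph.deleteEdges_adj] at hadj
        have := hA' ⟨s(x', y'), hadj.1⟩
        have hxe : ¬ ((⟨s(x', y'), hadj.1⟩ : G.edgeSet) = e) :=
          fun h' => hadj.2 (Set.mem_singleton_iff.2 (congrArg Subtype.val h'))
        rw [decide_eq_false hxe] at this
        rw [crossBool_mk] at this
        simpa using this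
    have h1 := hA' e
    simp only [he, crossBool_mk, hre u v hb] at h1
    simp at h1
  haveI := varIdeal_isPrime k T
  obtain ⟨q, hq, hqT⟩ := Ideal.exists_minimalPrimes_le hTle
  have hq2 : q.height = 2 := by
    rw [h q hq _ (pair_mem_minimalPrimes e), pair_height]
  have hqv := minimalPrime_eq_varIdeal hq
  set W : Finset (G.edgeSet × Bool) := Finset.univ.filter (fun i => X i ∈ q) with hW
  have hqW : q = varIdeal k (W : Set _) := by
    rw [hW]; simpa using hqv
  have hcard : W.card = 2 := by
    have := height_eq_card k W
    rw [← hqW, hq2] at this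
    exact_mod_cast this.symm
  obtain ⟨⟨f, b⟩, ⟨g, c⟩, hne, hWe⟩ := Finset.card_eq_two.1 hcard
  have hmem : ∀ i ∈ W, i ∈ T := by
    intro i hi
    exact X_mem_varIdeal.1 (hqT (by simpa [hW] using hi))
  have hf : b = decide (f ≠ e) := hmem (f, b) (by simp [hWe])
  have hg : c = decide (g ≠ e) := hmem (g, c) (by simp [hWe])
  have hfg : f ≠ g := by
    rintro rfl
    exact hne (by rw [hf, hg])
  obtain ⟨A, hA1, hA2⟩ := exists_cut_two f g hfg (!b) (!c)
  obtain ⟨x, hx⟩ := (cutIdeal_le_iff hq.1.1).1 hq.1.2 A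
  have hxW : (x, crossBool A x.1) ∈ W := by simpa [hW] using hx
  rw [hWe] at hxW
  simp only [Finset.mem_insert, Finset.mem_singleton, Prod.mk.injEq] at hxW
  rcases hxW with ⟨rfl, h2⟩ | ⟨rfl, h2⟩
  · rw [hA1] at h2; simp at h2
  · rw [hA2] at h2; simp at h2

end helpers

/-- For a finite simple connected graph `G`, the ideal `I(G)` is unmixed — all minimal
primes of `S/I(G)` have the same height — if and only if `G` is a tree. -/
theorem monomial_cut_ideal_unmixed_iff_tree
    (k : Type) [Field k] {V : Type} [Fintype V] [DecidableEq V]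
    (G : SimpleGraph V) [DecidableRel G.Adj] (hG : G.Connected) :
    (∀ p ∈ (cutIdeal k G).minimalPrimes, ∀ q ∈ (cutIdeal k G).minimalPrimes,
      ∀ (hp : p.IsPrime) (hq : q.IsPrime),
        Order.height (⟨p, hp⟩ : PrimeSpectrum (MvPolynomial (↥G.edgeSet × Bool) k)) =
          Order.height (⟨q, hq⟩ : PrimeSpectrum (MvPolynomial (↥G.edgeSet × Bool) k))) ↔
      G.IsTree := by
  have hh : ∀ (p : Ideal (MvPolynomial (↥G.edgeSet × Bool) k)) (hp : p.IsPrime),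
      Order.height (⟨p, hp⟩ : PrimeSpectrum (MvPolynomial (↥G.edgeSet × Bool) k)) = p.height :=
    fun p hp => (PrimeSpectrum.height_eq_orderHeight ⟨p, hp⟩).symm
  constructor
  · intro h
    refine ⟨hG, acyclic_of_heights (k := k) ?_⟩
    intro p hp q hq
    rw [← hh p hp.1.1, ← hh q hq.1.1]
    exact h p hp q hq _ _
  · intro h p hp q hq hp' hq'
    rw [hh, hh]
    obtain ⟨e, rfl⟩ := eq_pair_of_acyclic h.2 hp
    obtain ⟨f, rfl⟩ := eq_pair_of_acyclic h.2 hq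
    rw [pair_height, pair_height]
end

section
/- Let G be a finite simple connected graph. The monomial cut ideal I(G) is a complete intersection — that is, I(G) can be generated by a regular sequence of elements of S — if and only if G has exactly one edge (in which case I(G) = (s_{12}, t_{12})). -/
open MvPolynomial

/-- A nonzerodivisor modulo `I` avoids every minimal prime of `I`. -/
lemma cutAux_notMem_minimalPrime {R : Type} [CommRing R] (I q : Ideal R)
    (hq : q ∈ I.minimalPrimes) (x : R)
    (hx : Ideal.Quotient.mk I x ∈ nonZeroDivisors (R ⧸ I)) : x ∉ q := by
  intro hxq
  have h := Ideal.exists_minimalPrimes_comap_eq (I := (⊥ : Ideal (R ⧸ I)))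
    (Ideal.Quotient.mk I) q (by
      rw [← RingHom.ker_eq_comap_bot, Ideal.mk_ker]; exact hq)
  obtain ⟨p', hp', rfl⟩ := h
  exact notMem_nonZeroDivisors_of_mem_mem_minimalPrimes (Ideal.mem_comap.1 hxq) hp' hx

/-- A prime containing the first `i` elements of a regular sequence has height at least `i`. -/
lemma cutAux_height {R : Type} [CommRing R] {n : ℕ} (x : Fin n → R)
    (hx : ∀ i : Fin n, Ideal.Quotient.mk (Ideal.span {y | ∃ j, j < i ∧ y = x j}) (x i) ∈
      nonZeroDivisors (R ⧸ Ideal.span {y | ∃ j, j < i ∧ y = x j})) :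
    ∀ i : ℕ, i ≤ n → ∀ Q : Ideal R, Q.IsPrime → (∀ j : Fin n, j.1 < i → x j ∈ Q) →
      (i : ℕ∞) ≤ Q.height := by
  intro i
  induction i with
  | zero => intro _ Q _ _; simp
  | succ i ih =>
    intro hi Q hQ hmem
    have hle : Ideal.span {y | ∃ j, j < (⟨i, hi⟩ : Fin n) ∧ y = x j} ≤ Q := by
      rw [Ideal.span_le]
      rintro y ⟨j, hj, rfl⟩
      exact hmem j (Nat.lt_succ_of_lt hj)
    obtain ⟨q, hq, hqQ⟩ := Ideal.exists_minimalPrimes_le hle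
    have hqp : q.IsPrime := hq.1.1
    have hnot := cutAux_notMem_minimalPrime _ q hq _ (hx ⟨i, hi⟩)
    have hlt : q < Q := lt_of_le_of_ne hqQ (by
      rintro rfl
      exact hnot (hmem _ (Nat.lt_succ_self i)))
    have h1 := ih (by omega) q hqp (fun j hj => hq.1.2 (Ideal.subset_span ⟨j, hj, rfl⟩))
    have h2 := Ideal.height_add_one_le_of_lt_of_isPrime hlt
    push_cast
    exact (add_le_add_left h1 1).trans h2

/-- A regular sequence inside a proper ideal generated by two elements has length at most two. -/
lemma cutAux_length {R : Type} [CommRing R] [IsNoetherianRing R] {n : ℕ} (x : Fin n → R)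
    (hx : ∀ i : Fin n, Ideal.Quotient.mk (Ideal.span {y | ∃ j, j < i ∧ y = x j}) (x i) ∈
      nonZeroDivisors (R ⧸ Ideal.span {y | ∃ j, j < i ∧ y = x j}))
    (a b : R) (hab : Ideal.span {a, b} ≠ ⊤) (hmem : ∀ j, x j ∈ Ideal.span {a, b}) : n ≤ 2 := by
  obtain ⟨Q, hQ⟩ := Ideal.nonempty_minimalPrimes hab
  have h1 := Ideal.height_le_spanRank_toENat_of_mem_minimalPrimes _ Q hQ
  have h2 := cutAux_height x hx n le_rfl Q hQ.1.1 (fun j _ => hQ.1.2 (hmem j))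
  have h3 : (Ideal.span {a, b}).spanRank.toENat ≤ 2 := by
    have h4 := Cardinal.toENat.monotone' (Submodule.spanRank_span_le_card (R := R) {a, b})
    refine h4.trans ?_
    have h5 : ({a, b} : Set R).encard ≤ 2 := by
      refine (Set.encard_insert_le _ _).trans ?_
      rw [Set.encard_singleton]; norm_num
    exact h5
  exact_mod_cast h2.trans (h1.trans h3)

/-- A family of distinct monomials of degree `d` in an ideal all of whose elements have order
at least `d` bounds the number of generators from below. -/
lemma cutAux_gens {k σ : Type} [Field k] {n r d : ℕ} (x : Fin n → MvPolynomial σ k)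
    (m : Fin r → σ →₀ ℕ) (hm : Function.Injective m) (hd : ∀ i, (m i).degree = d)
    (hlow : ∀ f ∈ Ideal.span (Set.range x), ∀ a : σ →₀ ℕ, a.degree < d → coeff a f = 0)
    (hmem : ∀ i, monomial (m i) (1 : k) ∈ Ideal.span (Set.range x)) : r ≤ n := by
  classical
  let L : MvPolynomial σ k →ₗ[k] (Fin r → k) := LinearMap.pi fun i => lcoeff k (m i)
  have hL : ∀ f i, L f i = coeff (m i) f := fun f i => rfl
  have key : ∀ f ∈ Ideal.span (Set.range x), ∀ g, L (g * f) = coeff 0 g • L f := by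
    intro f hf g
    ext i
    rw [hL, coeff_mul, Finset.sum_eq_single (0, m i)]
    · simp [hL]
    · rintro ⟨a, b⟩ hab hne
      rw [Finset.HasAntidiagonal.mem_antidiagonal] at hab
      simp only at hab ⊢
      rw [hlow f hf b, mul_zero]
      have h1 : a.degree + b.degree = d := by rw [← hd i, ← hab, map_add]
      have h2 : a.degree ≠ 0 := by
        intro h0
        rw [Finsupp.degree_eq_zero_iff] at h0
        subst h0
        apply hne
        rw [← hab, zero_add]
      omega
    · simp
  have hspan : ∀ f ∈ Ideal.span (Set.range x), L f ∈ Submodule.span k (Set.range (L ∘ x)) := by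
    intro f hf
    obtain ⟨c, rfl⟩ := (Ideal.mem_span_range_iff_exists_fun).1 hf
    rw [map_sum]
    refine Submodule.sum_mem _ fun j _ => ?_
    rw [key _ (Ideal.subset_span ⟨j, rfl⟩)]
    exact Submodule.smul_mem _ _ (Submodule.subset_span ⟨j, rfl⟩)
  have htop : Submodule.span k (Set.range (L ∘ x)) = ⊤ := by
    rw [eq_top_iff, ← (Pi.basisFun k (Fin r)).span_eq, Submodule.span_le]
    rintro _ ⟨i, rfl⟩
    have h := hspan _ (hmem i)
    have hb : L (monomial (m i) 1) = Pi.basisFun k (Fin r) i := by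
      ext j
      rw [hL, coeff_monomial, Pi.basisFun_apply, Pi.single_apply]
      simp only [hm.eq_iff, eq_comm]
    rw [hb] at h
    exact h
  have h := finrank_range_le_card (R := k) (L ∘ x)
  rw [Set.finrank, htop, finrank_top] at h
  simpa using h

section
variable {k : Type} [Field k] {V : Type} [DecidableEq V] (G : SimpleGraph V) [Fintype G.edgeSet]

/-- Exponent of the cut monomial. -/
noncomputable def cutAuxExp (A : Finset V) : (↥G.edgeSet × Bool) →₀ ℕ :=
  ∑ e : ↥G.edgeSet, Finsupp.single (e, crossBool A e.1) 1

lemma cutAux_exp_degree (A : Finset V) :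
    (cutAuxExp G A).degree = Fintype.card ↥G.edgeSet := by
  simp [cutAuxExp, map_sum]

lemma cutAux_exp_apply (A : Finset V) (e : ↥G.edgeSet) (b : Bool) :
    cutAuxExp G A (e, b) = if crossBool A e.1 = b then 1 else 0 := by
  classical
  rw [cutAuxExp, Finsupp.finsetSum_apply, Finset.sum_eq_single e]
  · simp [Finsupp.single_apply]
  · intro e' _ hne
    simp [hne]
  · simp

lemma cutAux_gen_prod (h : ↑G.edgeSet.toFinset ⊆ G.edgeSet) (A : Finset V) :
    cutGen k G G.edgeSet.toFinset h A = ∏ e : ↥G.edgeSet, X (e, crossBool A e.1) := by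
  rw [cutGen]
  refine Finset.prod_bij (fun e _ => ⟨e.1, h e.2⟩) (by simp) ?_ ?_ (by simp)
  · intro a _ b _ hab
    ext1
    simpa using hab
  · intro b _
    exact ⟨⟨b.1, by simp⟩, by simp, rfl⟩

lemma cutAux_gen_monomial (h : ↑G.edgeSet.toFinset ⊆ G.edgeSet) (A : Finset V) :
    cutGen k G G.edgeSet.toFinset h A = monomial (cutAuxExp G A) 1 := by
  rw [cutAux_gen_prod, cutAuxExp, monomial_sum_one]
  rfl

lemma cutAux_low (f : MvPolynomial (↥G.edgeSet × Bool) k) (hf : f ∈ cutIdeal k G)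
    (a : (↥G.edgeSet × Bool) →₀ ℕ) (ha : a.degree < Fintype.card ↥G.edgeSet) :
    coeff a f = 0 := by
  rw [cutIdeal, cutIdealOn] at hf
  induction hf using Submodule.span_induction generalizing a with
  | mem x hx =>
    obtain ⟨A, rfl⟩ := hx
    rw [cutAux_gen_monomial, coeff_monomial, if_neg]
    rintro rfl
    rw [cutAux_exp_degree] at ha
    exact lt_irrefl _ ha
  | zero => simp
  | add x y _ _ hx hy => rw [coeff_add, hx a ha, hy a ha, add_zero]
  | smul g x _ hx =>
    classical
    rw [smul_eq_mul, coeff_mul]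
    refine Finset.sum_eq_zero fun p hp => ?_
    rw [Finset.HasAntidiagonal.mem_antidiagonal] at hp
    rw [hx p.2 ?_, mul_zero]
    have : p.1.degree + p.2.degree = a.degree := by rw [← hp, map_add]
    omega

/-- The cut ideal lies in `(s_e, t_e)`. -/
lemma cutAux_le (e : ↥G.edgeSet) :
    cutIdeal k G ≤ Ideal.span {X (e, true), X (e, false)} := by
  rw [cutIdeal, cutIdealOn, Ideal.span_le]
  rintro _ ⟨A, rfl⟩
  rw [cutAux_gen_prod]
  refine Ideal.mem_of_dvd _ (Finset.dvd_prod_of_mem _ (Finset.mem_univ e)) ?_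
  apply Ideal.subset_span
  cases crossBool A e.1 <;> simp

lemma cutAux_pair_ne_top (e : ↥G.edgeSet) :
    (Ideal.span {X (e, true), X (e, false)} : Ideal (MvPolynomial (↥G.edgeSet × Bool) k)) ≠ ⊤ := by
  intro h
  have h1 : Ideal.span {X (e, true), X (e, false)} ≤
      RingHom.ker (constantCoeff : MvPolynomial (↥G.edgeSet × Bool) k →+* k) := by
    rw [Ideal.span_le]
    rintro _ (rfl | rfl) <;> simp [RingHom.mem_ker]
  rw [h] at h1
  have : (1 : MvPolynomial (↥G.edgeSet × Bool) k) ∈ RingHom.ker constantCoeff := h1 trivial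
  simp [RingHom.mem_ker] at this

end

lemma cutAux_cross_singleton {V : Type} [DecidableEq V] (a : V) (e : Sym2 V) (he : ¬ e.IsDiag) :
    crossBool {a} e = decide (a ∈ e) := by
  induction e using Sym2.ind with
  | _ i j =>
    have hij : i ≠ j := by simpa using he
    simp only [crossBool, Sym2.lift_mk, Finset.mem_singleton, Sym2.mem_iff]
    by_cases h1 : i = a <;> by_cases h2 : j = a <;> simp_all [eq_comm (a := a)]

lemma cutAux_cross_empty {V : Type} [DecidableEq V] (e : Sym2 V) :
    crossBool ∅ e = false := by
  induction e using Sym2.ind with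
  | _ i j => simp [crossBool]

lemma cutAux_exists_mem {V : Type} (e f : Sym2 V) (he : ¬ e.IsDiag) (hne : e ≠ f) :
    ∃ a, a ∈ e ∧ a ∉ f := by
  by_contra! h
  induction e using Sym2.ind with
  | _ i j =>
    have hij : i ≠ j := by simpa using he
    exact hne ((Sym2.mem_and_mem_iff hij).1 ⟨h i (by simp), h j (by simp)⟩).symm

/-- For a finite simple connected graph `G`, the monomial cut ideal `I(G)` is a complete
intersection — i.e. it can be generated by a regular sequence `x_0, …, x_{n-1}` of
elements of `S` (each `x_i` is a nonzerodivisor on `S/(x_0, …, x_{i-1})` and the `x_i`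
generate a proper ideal) — if and only if `G` has exactly one edge. -/
theorem monomial_cut_ideal_complete_intersection_iff
    (k : Type) [Field k] {V : Type} [Fintype V] [DecidableEq V]
    (G : SimpleGraph V) [DecidableRel G.Adj] (hG : G.Connected) :
    (∃ (n : ℕ) (x : Fin n → MvPolynomial (↥G.edgeSet × Bool) k),
      Ideal.span (Set.range x) = cutIdeal k G ∧
      Ideal.span (Set.range x) ≠ ⊤ ∧
      ∀ i : Fin n,
        Ideal.Quotient.mk (Ideal.span {y | ∃ j, j < i ∧ y = x j}) (x i) ∈
          nonZeroDivisors
            (MvPolynomial (↥G.edgeSet × Bool) k ⧸ Ideal.span {y | ∃ j, j < i ∧ y = x j})) ↔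
      Fintype.card ↥G.edgeSet = 1 := by
  constructor
  · rintro ⟨n, x, hI, htop, hreg⟩
    by_contra hcard
    rcases Nat.lt_or_gt_of_ne hcard with h0 | h2
    · -- no edges: the ideal is the unit ideal
      have : IsEmpty ↥G.edgeSet := Fintype.card_eq_zero_iff.1 (by omega)
      apply htop
      rw [hI, Ideal.eq_top_iff_one, cutIdeal, cutIdealOn]
      apply Ideal.subset_span
      refine ⟨∅, ?_⟩
      rw [cutAux_gen_prod]
      simp
    · obtain ⟨e, f, hef⟩ := Fintype.one_lt_card_iff.1 h2
      have hne : e.1 ≠ f.1 := fun h => hef (Subtype.ext h)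
      have he := G.not_isDiag_of_mem_edgeSet e.2
      have hf := G.not_isDiag_of_mem_edgeSet f.2
      have hn : n ≤ 2 := cutAux_length x hreg _ _ (cutAux_pair_ne_top (k := k) G e)
        (fun j => cutAux_le G e (hI ▸ Ideal.subset_span ⟨j, rfl⟩))
      obtain ⟨a, hae, haf⟩ := cutAux_exists_mem _ _ he hne
      obtain ⟨b, hbf, hbe⟩ := cutAux_exists_mem _ _ hf hne.symm
      let A : Fin 3 → Finset V := ![∅, {a}, {b}]
      have hinj : Function.Injective (fun i => cutAuxExp G (A i)) := by
        intro i j hij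
        have h1 := DFunLike.congr_fun hij (e, true)
        have h2 := DFunLike.congr_fun hij (f, true)
        simp only [cutAux_exp_apply] at h1 h2
        fin_cases i <;> fin_cases j <;>
          simp [A, cutAux_cross_empty, cutAux_cross_singleton, he, hf, hae, haf, hbe, hbf]
            at h1 h2 ⊢
      have h3 : 3 ≤ n := cutAux_gens x _ hinj (fun i => cutAux_exp_degree G (A i))
        (fun f hf => cutAux_low G f (hI ▸ hf)) (fun i => by
          rw [hI, ← cutAux_gen_monomial G (by simp) (A i)]
          exact Ideal.subset_span ⟨A i, rfl⟩)
      omega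
  · intro hcard
    obtain ⟨e, he⟩ := Fintype.card_eq_one_iff.1 hcard
    have hrange : Set.range (![X (e, true), X (e, false)] :
        Fin 2 → MvPolynomial (↥G.edgeSet × Bool) k) = {X (e, true), X (e, false)} := by
      simp [Matrix.range_cons, Set.pair_comm]
    refine ⟨2, ![X (e, true), X (e, false)], ?_, ?_, ?_⟩
    · rw [hrange]
      refine le_antisymm ?_ (cutAux_le G e)
      have huniv : (Finset.univ : Finset ↥G.edgeSet) = {e} := by
        ext y; simp [he y]
      have hgen : ∀ A, X (e, crossBool A e.1) ∈ cutIdeal k G := by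
        intro A
        rw [cutIdeal, cutIdealOn]
        apply Ideal.subset_span
        refine ⟨A, ?_⟩
        rw [cutAux_gen_prod, huniv, Finset.prod_singleton]
      have hd := G.not_isDiag_of_mem_edgeSet e.2
      rw [Ideal.span_le]
      rintro _ (rfl | rfl)
      · have h := hgen {(Quot.out e.1).1}
        rw [cutAux_cross_singleton _ _ hd, decide_eq_true (Sym2.out_fst_mem e.1)] at h
        exact h
      · have h := hgen ∅
        rw [cutAux_cross_empty] at h
        exact h
    · rw [hrange]; exact cutAux_pair_ne_top G e
    · have gen : ∀ (J : Ideal (MvPolynomial (↥G.edgeSet × Bool) k)) (_ : J.IsPrime)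
          (y : MvPolynomial (↥G.edgeSet × Bool) k), y ∉ J →
          Ideal.Quotient.mk J y ∈ nonZeroDivisors (_ ⧸ J) := by
        intro J hJ y hy
        apply mem_nonZeroDivisors_of_ne_zero
        rwa [Ne, Ideal.Quotient.eq_zero_iff_mem]
      intro i
      fin_cases i
      · have h0 : Ideal.span {y | ∃ j, j < (0 : Fin 2) ∧ y = (![X (e, true), X (e, false)] :
            Fin 2 → MvPolynomial (↥G.edgeSet × Bool) k) j} = ⊥ := by
          simp
        apply gen
        · exact h0 ▸ Ideal.isPrime_bot
        · intro hmem
          have hmem' := h0 ▸ hmem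
          simp at hmem'
      · have h0 : Ideal.span {y | ∃ j, j < (1 : Fin 2) ∧ y = (![X (e, true), X (e, false)] :
            Fin 2 → MvPolynomial (↥G.edgeSet × Bool) k) j} = Ideal.span {X (e, true)} := by
          congr 1
          ext y
          simp [Fin.exists_fin_two]
        apply gen
        · exact h0 ▸ (Ideal.span_singleton_prime (X_ne_zero _)).2 (X_prime)
        · intro hmem
          have hmem' := h0 ▸ hmem
          rw [Ideal.mem_span_singleton] at hmem'
          simp [X_dvd_X] at hmem'
end
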